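/- arXiv:2310.13858 — 14 statements merged into one kernel-verified Lean document; each statement's English description precedes it below -/
import Mathlib

section
/- Let Δ₁,…,Δ_M be symmetric positive definite p×p real matrices, f₁,…,f_M positive reals with Σ_{m=1}^M f_m = 1, Δ = Σ_{m=1}^M f_m Δ_m, Σ_u a symmetric positive semidefinite p×p matrix, Σ_x a symmetric positive definite p×p matrix such that Σ_x − Δ is positive definite, and L = Δ(Δ + Σ_u)⁻¹. Then for every p×q real matrix Ψ₀ of full column rank q (with 1 ≤ q ≤ p), Σ_{m=1}^M f_m · log det(Ψ₀ᵀ (L(Δ_m + Σ_u)Lᵀ)⁻¹ Ψ₀) ≥ log det(Ψ₀ᵀ (L(Σ_x + Σ_u)Lᵀ)⁻¹ Ψ₀). -/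
open Matrix BigOperators

section helpers

open scoped MatrixOrder in
lemma exists_factor {n : ℕ} {B : Matrix (Fin n) (Fin n) ℝ} (hB : B.PosSemidef) :
    ∃ R : Matrix (Fin n) (Fin n) ℝ, B = Rᵀ * R := by
  obtain ⟨R, hR⟩ := CStarAlgebra.nonneg_iff_eq_star_mul_self.mp hB.nonneg
  exact ⟨R, by rw [hR, star_eq_conjTranspose, conjTranspose_eq_transpose_of_trivial]⟩

lemma trace_mul_nonneg' {n : ℕ} {B P : Matrix (Fin n) (Fin n) ℝ} (hB : B.PosSemidef)
    (hP : P.PosSemidef) : 0 ≤ (B * P).trace := by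
  obtain ⟨R, rfl⟩ := exists_factor hB
  have h := (hP.mul_mul_conjTranspose_same R).trace_nonneg
  rw [conjTranspose_eq_transpose_of_trivial] at h
  rwa [Matrix.mul_assoc, trace_mul_comm]

lemma log_det_le_trace {n : ℕ} {C : Matrix (Fin n) (Fin n) ℝ} (hC : C.PosDef) :
    Real.log C.det ≤ C.trace - n := by
  rw [hC.1.det_eq_prod_eigenvalues, hC.1.trace_eq_sum_eigenvalues]
  simp only [RCLike.ofReal_real_eq_id, id]
  rw [Real.log_prod (fun i _ => (hC.eigenvalues_pos i).ne')]
  calc ∑ i, Real.log (hC.1.eigenvalues i) ≤ ∑ i, (hC.1.eigenvalues i - 1) :=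
        Finset.sum_le_sum fun i _ => Real.log_le_sub_one_of_pos (hC.eigenvalues_pos i)
    _ = _ := by simp

lemma log_det_sub_le {n : ℕ} {A B : Matrix (Fin n) (Fin n) ℝ} (hA : A.PosDef) (hB : B.PosDef) :
    Real.log B.det - Real.log A.det ≤ (B * A⁻¹).trace - n := by
  obtain ⟨R, hR⟩ := exists_factor hB.posSemidef
  have hdet : B.det = R.det * R.det := by rw [hR, det_mul, det_transpose]
  have hRu : IsUnit R := by
    rw [isUnit_iff_isUnit_det, isUnit_iff_ne_zero]
    intro h
    have := hB.det_pos
    rw [hdet, h] at this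
    simp at this
  have hC : (R * A⁻¹ * Rᵀ).PosDef := by
    rw [← conjTranspose_eq_transpose_of_trivial]
    exact hA.inv.mul_mul_conjTranspose_same (vecMul_injective_iff_isUnit.2 hRu)
  have h := log_det_le_trace hC
  have e1 : (R * A⁻¹ * Rᵀ).trace = (B * A⁻¹).trace := by
    rw [hR, Matrix.mul_assoc Rᵀ, trace_mul_comm]
  have e2 : (R * A⁻¹ * Rᵀ).det = B.det / A.det := by
    rw [det_mul, det_mul, det_transpose, hdet, det_nonsing_inv, Ring.inverse_eq_inv']
    ring
  rw [e1, e2, Real.log_div hB.det_pos.ne' hA.det_pos.ne'] at h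
  exact h

lemma gauss_markov {p q : ℕ} {X : Matrix (Fin p) (Fin p) ℝ} (hX : X.PosDef)
    {Ψ W : Matrix (Fin p) (Fin q) ℝ} (hA : (Ψᵀ * X⁻¹ * Ψ).PosDef) (hW : Wᵀ * Ψ = 1) :
    (Wᵀ * X * W - (Ψᵀ * X⁻¹ * Ψ)⁻¹).PosSemidef := by
  have hW' : Ψᵀ * W = 1 := by
    have := congrArg transpose hW
    simpa using this
  have hXt : Xᵀ = X := by simpa using hX.1.eq
  have hAt : (Ψᵀ * X⁻¹ * Ψ)ᵀ = Ψᵀ * X⁻¹ * Ψ := by simpa using hA.1.eq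
  have hXu : IsUnit X.det := (isUnit_iff_isUnit_det _).1 hX.isUnit
  have hAu : IsUnit (Ψᵀ * X⁻¹ * Ψ).det := (isUnit_iff_isUnit_det _).1 hA.isUnit
  generalize hAA : Ψᵀ * X⁻¹ * Ψ = A at *
  have h := hX.posSemidef.conjTranspose_mul_mul_same (W - X⁻¹ * Ψ * A⁻¹)
  rw [conjTranspose_eq_transpose_of_trivial] at h
  convert h using 1
  have e1 : (W - X⁻¹ * Ψ * A⁻¹)ᵀ = Wᵀ - A⁻¹ * (Ψᵀ * X⁻¹) := by
    rw [transpose_sub, transpose_mul, transpose_mul, transpose_nonsing_inv,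
      transpose_nonsing_inv, hXt, hAt]
  have e2 : X * (X⁻¹ * Ψ * A⁻¹) = Ψ * A⁻¹ := by
    rw [Matrix.mul_assoc, ← Matrix.mul_assoc X, mul_nonsing_inv _ hXu, Matrix.one_mul]
  have e3 : A⁻¹ * (Ψᵀ * X⁻¹) * (X * W) = A⁻¹ := by
    rw [Matrix.mul_assoc, Matrix.mul_assoc Ψᵀ, ← Matrix.mul_assoc X⁻¹, nonsing_inv_mul _ hXu,
      Matrix.one_mul, hW', Matrix.mul_one]
  have e4 : A⁻¹ * (Ψᵀ * X⁻¹) * (Ψ * A⁻¹) = A⁻¹ := by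
    rw [Matrix.mul_assoc, ← Matrix.mul_assoc (Ψᵀ * X⁻¹), hAA, mul_nonsing_inv _ hAu,
      Matrix.mul_one]
  have e5 : Wᵀ * (Ψ * A⁻¹) = A⁻¹ := by
    rw [← Matrix.mul_assoc, hW, Matrix.one_mul]
  rw [e1, Matrix.mul_assoc (Wᵀ - _), Matrix.mul_sub X, e2, Matrix.sub_mul, Matrix.mul_sub,
    Matrix.mul_sub, e3, e4, e5, Matrix.mul_assoc]
  simp

lemma mulVec_inj_of_rank {p q : ℕ} {Ψ : Matrix (Fin p) (Fin q) ℝ} (h : Ψ.rank = q) :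
    Function.Injective Ψ.mulVec := by
  have h1 := LinearMap.finrank_range_add_finrank_ker Ψ.mulVecLin
  have h2 : Module.finrank ℝ (LinearMap.range Ψ.mulVecLin) = q := h
  rw [h2] at h1
  have h3 : Module.finrank ℝ (LinearMap.ker Ψ.mulVecLin) = 0 := by
    simp at h1; simpa using h1
  have h4 := LinearMap.ker_eq_bot.1 (Submodule.finrank_eq_zero.1 h3)
  exact h4

lemma general_ineq {p q M : ℕ} (X : Fin M → Matrix (Fin p) (Fin p) ℝ) (hX : ∀ m, (X m).PosDef)
    (f : Fin M → ℝ) (hf : ∀ m, 0 < f m) (hfsum : ∑ m, f m = 1)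
    (S : Matrix (Fin p) (Fin p) ℝ) (hS : S.PosDef) (hd : (S - ∑ m, f m • X m).PosSemidef)
    (Ψ : Matrix (Fin p) (Fin q) ℝ) (hrank : Ψ.rank = q) :
    Real.log ((Ψᵀ * S⁻¹ * Ψ).det) ≤ ∑ m, f m * Real.log ((Ψᵀ * (X m)⁻¹ * Ψ).det) := by
  have hinj := mulVec_inj_of_rank hrank
  have key : ∀ Y : Matrix (Fin p) (Fin p) ℝ, Y.PosDef → (Ψᵀ * Y⁻¹ * Ψ).PosDef := by
    intro Y hY
    have := hY.inv.conjTranspose_mul_mul_same hinj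
    rwa [conjTranspose_eq_transpose_of_trivial] at this
  have hB := key S hS
  have hSt : Sᵀ = S := by simpa using hS.1.eq
  have hBt : (Ψᵀ * S⁻¹ * Ψ)ᵀ = Ψᵀ * S⁻¹ * Ψ := by simpa using hB.1.eq
  have hSu : IsUnit S.det := (isUnit_iff_isUnit_det _).1 hS.isUnit
  have hBu : IsUnit (Ψᵀ * S⁻¹ * Ψ).det := (isUnit_iff_isUnit_det _).1 hB.isUnit
  generalize hBB : Ψᵀ * S⁻¹ * Ψ = B at *
  obtain ⟨W, hWdef⟩ : ∃ W, W = S⁻¹ * Ψ * B⁻¹ := ⟨_, rfl⟩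
  have hWt : Wᵀ = B⁻¹ * (Ψᵀ * S⁻¹) := by
    rw [hWdef, transpose_mul, transpose_mul, transpose_nonsing_inv,
      transpose_nonsing_inv, hSt, hBt]
  have hW : Wᵀ * Ψ = 1 := by
    rw [hWt, Matrix.mul_assoc, hBB, nonsing_inv_mul _ hBu]
  have hWS : Wᵀ * S * W = B⁻¹ := by
    have : S * W = Ψ * B⁻¹ := by
      rw [hWdef, Matrix.mul_assoc, ← Matrix.mul_assoc S, mul_nonsing_inv _ hSu, Matrix.one_mul]
    rw [Matrix.mul_assoc, this, ← Matrix.mul_assoc, hW, Matrix.one_mul]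
  have step : ∀ m, Real.log B.det - Real.log (Ψᵀ * (X m)⁻¹ * Ψ).det
      ≤ (B * (Wᵀ * X m * W)).trace - q := by
    intro m
    have h1 := log_det_sub_le (key _ (hX m)) hB
    have h2 := trace_mul_nonneg' hB.posSemidef (gauss_markov (hX m) (key _ (hX m)) hW)
    rw [Matrix.mul_sub, trace_sub] at h2
    linarith
  have hsum : ∑ m, f m * (Real.log B.det - Real.log (Ψᵀ * (X m)⁻¹ * Ψ).det)
      ≤ ∑ m, f m * ((B * (Wᵀ * X m * W)).trace - q) :=
    Finset.sum_le_sum fun m _ => mul_le_mul_of_nonneg_left (step m) (hf m).le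
  simp only [mul_sub, Finset.sum_sub_distrib, ← Finset.sum_mul, hfsum, one_mul] at hsum
  have ht : ∑ m, f m * (B * (Wᵀ * X m * W)).trace
      = (B * (Wᵀ * (∑ m, f m • X m) * W)).trace := by
    simp [Matrix.mul_sum, Matrix.sum_mul, trace_sum]
  have hle := trace_mul_nonneg' hB.posSemidef (hd.conjTranspose_mul_mul_same W)
  rw [conjTranspose_eq_transpose_of_trivial, Matrix.mul_sub, Matrix.sub_mul, Matrix.mul_sub,
    trace_sub, hWS, mul_nonsing_inv _ hBu, trace_one, Fintype.card_fin] at hle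
  rw [ht] at hsum
  linarith

end helpers

/-- Optimality inequality for the population corrected-LAD criterion (Theorem 2, cLAD part). -/
theorem cLAD_population_inequality {p q M : ℕ} (hq1 : 1 ≤ q) (hqp : q ≤ p)
    (Δm : Fin M → Matrix (Fin p) (Fin p) ℝ) (hΔm : ∀ m, (Δm m).PosDef)
    (f : Fin M → ℝ) (hf : ∀ m, 0 < f m) (hfsum : ∑ m, f m = 1)
    (Δ : Matrix (Fin p) (Fin p) ℝ) (hΔ : Δ = ∑ m, f m • Δm m)
    (σu : Matrix (Fin p) (Fin p) ℝ) (hσu : σu.PosSemidef)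
    (σx : Matrix (Fin p) (Fin p) ℝ) (hσx : σx.PosDef)
    (hdiff : (σx - Δ).PosDef)
    (L : Matrix (Fin p) (Fin p) ℝ) (hL : L = Δ * (Δ + σu)⁻¹)
    (Ψ₀ : Matrix (Fin p) (Fin q) ℝ) (hrank : Ψ₀.rank = q) :
    ∑ m, f m * Real.log ((Ψ₀ᵀ * (L * (Δm m + σu) * Lᵀ)⁻¹ * Ψ₀).det)
      ≥ Real.log ((Ψ₀ᵀ * (L * (σx + σu) * Lᵀ)⁻¹ * Ψ₀).det) := by
  have hne : (Finset.univ : Finset (Fin M)).Nonempty := by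
    by_contra h
    rw [Finset.not_nonempty_iff_eq_empty] at h
    rw [h] at hfsum
    simp at hfsum
  have hΔp : Δ.PosDef := by
    rw [hΔ]
    exact posDef_sum hne fun i _ => (hΔm i).smul (hf i)
  have hLu : IsUnit L := by
    rw [hL]
    exact hΔp.isUnit.mul (hΔp.add_posSemidef hσu).inv.isUnit
  have hpd : ∀ Y : Matrix (Fin p) (Fin p) ℝ, Y.PosDef → (L * Y * Lᵀ).PosDef := by
    intro Y hY
    rw [← conjTranspose_eq_transpose_of_trivial]
    exact hY.mul_mul_conjTranspose_same (vecMul_injective_iff_isUnit.2 hLu)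
  apply general_ineq _ (fun m => hpd _ ((hΔm m).add_posSemidef hσu)) f hf hfsum _
    (hpd _ (hσx.add_posSemidef hσu)) _ Ψ₀ hrank
  have e : L * (σx + σu) * Lᵀ - ∑ m, f m • (L * (Δm m + σu) * Lᵀ) = L * (σx - Δ) * Lᵀ := by
    have : ∑ m, f m • (L * (Δm m + σu) * Lᵀ) = L * (Δ + σu) * Lᵀ := by
      have h2 : Δ + σu = ∑ m, f m • (Δm m + σu) := by
        simp only [smul_add, Finset.sum_add_distrib, ← Finset.sum_smul, hfsum, one_smul, hΔ]
      rw [h2]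
      simp only [Matrix.mul_sum, Matrix.sum_mul, Matrix.mul_smul, Matrix.smul_mul]
    rw [this, ← Matrix.sub_mul, ← Matrix.mul_sub, add_sub_add_right_eq_sub]
  rw [e]
  exact (hpd _ hdiff).posSemidef
end

section
/- Let Δ₁,…,Δ_M be symmetric positive definite p×p real matrices, f₁,…,f_M positive reals with Σ_{m=1}^M f_m = 1, Δ = Σ_{m=1}^M f_m Δ_m, Σ_u a symmetric positive semidefinite p×p matrix, Σ_x a symmetric positive definite p×p matrix, and L = Δ(Δ + Σ_u)⁻¹. Suppose Φ₀ is a p×q real matrix of full column rank q such that Φ₀ᵀ Δ_m⁻¹ = Φ₀ᵀ Δ⁻¹ for every m = 1,…,M and Φ₀ᵀ Σ_x⁻¹ = Φ₀ᵀ Δ⁻¹. Then Σ_{m=1}^M f_m · log det(Φ₀ᵀ (L(Δ_m + Σ_u)Lᵀ)⁻¹ Φ₀) = log det(Φ₀ᵀ (L(Σ_x + Σ_u)Lᵀ)⁻¹ Φ₀). -/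
open Matrix BigOperators

theorem save_aux {p q : ℕ} (Δ σu S : Matrix (Fin p) (Fin p) ℝ) (hΔ : Δ.PosDef)
    (hσu : σu.PosSemidef) (hS : S.PosDef) (Φ : Matrix (Fin p) (Fin q) ℝ)
    (h : Φᵀ * S⁻¹ = Φᵀ * Δ⁻¹) :
    Φᵀ * ((Δ * (Δ + σu)⁻¹) * (S + σu) * (Δ * (Δ + σu)⁻¹)ᵀ)⁻¹ * Φ
      = Φᵀ * Δ⁻¹ * ((Δ + σu) * Δ⁻¹) * Φ := by
  have uΔ : IsUnit Δ.det := hΔ.det_pos.ne'.isUnit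
  have uS : IsUnit S.det := hS.det_pos.ne'.isUnit
  have uT : IsUnit (Δ + σu).det := (hΔ.add_posSemidef hσu).det_pos.ne'.isUnit
  have uA : IsUnit (S + σu).det := (hS.add_posSemidef hσu).det_pos.ne'.isUnit
  have tΔ : Δᵀ = Δ := by simpa using hΔ.isHermitian.eq
  have tu : σuᵀ = σu := by simpa using hσu.isHermitian.eq
  have key : Φᵀ * Δ⁻¹ * (Δ + σu) = Φᵀ * Δ⁻¹ * (S + σu) := by
    rw [Matrix.mul_add, Matrix.mul_add, Matrix.nonsing_inv_mul_cancel_right _ _ uΔ, ← h,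
      Matrix.nonsing_inv_mul_cancel_right _ _ uS]
  rw [Matrix.transpose_mul, Matrix.transpose_nonsing_inv, Matrix.transpose_add, tΔ, tu]
  simp only [Matrix.mul_inv_rev, Matrix.nonsing_inv_nonsing_inv _ uT]
  rw [← Matrix.mul_assoc, ← Matrix.mul_assoc, ← Matrix.mul_assoc Φᵀ, key,
    Matrix.mul_nonsing_inv_cancel_right _ _ uA, Matrix.mul_assoc (Φᵀ * Δ⁻¹)]

/-- Equality case of the corrected-LAD population criterion at the SAVE subspace
(equation (SAVE) in the proof of Theorem 2). -/
theorem cLAD_equality_at_SAVE {p q M : ℕ} (hq1 : 1 ≤ q) (hqp : q ≤ p)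
    (Δm : Fin M → Matrix (Fin p) (Fin p) ℝ) (hΔm : ∀ m, (Δm m).PosDef)
    (f : Fin M → ℝ) (hf : ∀ m, 0 < f m) (hfsum : ∑ m, f m = 1)
    (Δ : Matrix (Fin p) (Fin p) ℝ) (hΔ : Δ = ∑ m, f m • Δm m)
    (σu : Matrix (Fin p) (Fin p) ℝ) (hσu : σu.PosSemidef)
    (σx : Matrix (Fin p) (Fin p) ℝ) (hσx : σx.PosDef)
    (L : Matrix (Fin p) (Fin p) ℝ) (hL : L = Δ * (Δ + σu)⁻¹)
    (Φ₀ : Matrix (Fin p) (Fin q) ℝ) (hrank : Φ₀.rank = q)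
    (hΦΔm : ∀ m, Φ₀ᵀ * (Δm m)⁻¹ = Φ₀ᵀ * Δ⁻¹)
    (hΦσx : Φ₀ᵀ * σx⁻¹ = Φ₀ᵀ * Δ⁻¹) :
    ∑ m, f m * Real.log ((Φ₀ᵀ * (L * (Δm m + σu) * Lᵀ)⁻¹ * Φ₀).det)
      = Real.log ((Φ₀ᵀ * (L * (σx + σu) * Lᵀ)⁻¹ * Φ₀).det) := by
  have hΔpd : Δ.PosDef := by
    have hne : (Finset.univ : Finset (Fin M)).Nonempty := by
      by_contra hc
      rw [Finset.not_nonempty_iff_eq_empty] at hc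
      rw [hc] at hfsum
      simp at hfsum
    rw [hΔ]
    exact Matrix.posDef_sum hne fun m _ => (hΔm m).smul (hf m)
  subst hL
  rw [save_aux Δ σu σx hΔpd hσu hσx Φ₀ hΦσx]
  simp only [fun m => save_aux Δ σu (Δm m) hΔpd hσu (hΔm m) Φ₀ (hΦΔm m)]
  rw [← Finset.sum_mul, hfsum, one_mul]
end

section
/- Let Δ and Δ_m be symmetric positive definite p×p real matrices and Σ_u a symmetric positive semidefinite p×p real matrix, and set L = Δ(Δ + Σ_u)⁻¹. If Φ₀ is a p×q real matrix such that Φ₀ᵀ Δ_m⁻¹ = Φ₀ᵀ Δ⁻¹, then Φ₀ᵀ (L(Δ_m + Σ_u)Lᵀ)⁻¹ Φ₀ = Φ₀ᵀ Δ⁻¹ (I_p + Σ_u Δ⁻¹) Φ₀. In particular, the left-hand side does not depend on Δ_m. -/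
open Matrix

/-- Appendix C identity: the quadratic form of the SAVE complement in the inverse of the
within-slice covariance of the adjusted surrogate does not depend on the slice. -/
theorem slice_quadratic_form_identity {p q : ℕ}
    (Δ : Matrix (Fin p) (Fin p) ℝ) (hΔ : Δ.PosDef)
    (Δm : Matrix (Fin p) (Fin p) ℝ) (hΔm : Δm.PosDef)
    (σu : Matrix (Fin p) (Fin p) ℝ) (hσu : σu.PosSemidef)
    (L : Matrix (Fin p) (Fin p) ℝ) (hL : L = Δ * (Δ + σu)⁻¹)
    (Φ₀ : Matrix (Fin p) (Fin q) ℝ)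
    (hΦ : Φ₀ᵀ * Δm⁻¹ = Φ₀ᵀ * Δ⁻¹) :
    Φ₀ᵀ * (L * (Δm + σu) * Lᵀ)⁻¹ * Φ₀ = Φ₀ᵀ * Δ⁻¹ * (1 + σu * Δ⁻¹) * Φ₀ := by
  have dΔ : IsUnit Δ.det := (Matrix.isUnit_iff_isUnit_det _).1 hΔ.isUnit
  have dm : IsUnit Δm.det := (Matrix.isUnit_iff_isUnit_det _).1 hΔm.isUnit
  have dS : IsUnit (Δ + σu).det :=
    (Matrix.isUnit_iff_isUnit_det _).1 (hΔ.add_posSemidef hσu).isUnit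
  have dT : IsUnit (Δm + σu).det :=
    (Matrix.isUnit_iff_isUnit_det _).1 (hΔm.add_posSemidef hσu).isUnit
  have tΔ : Δᵀ = Δ := by
    have h := hΔ.isHermitian.eq
    rwa [Matrix.conjTranspose_eq_transpose_of_trivial] at h
  have tS : (Δ + σu)ᵀ = Δ + σu := by
    have h := (hΔ.add_posSemidef hσu).isHermitian.eq
    rwa [Matrix.conjTranspose_eq_transpose_of_trivial] at h
  have key : Φ₀ᵀ * Δ⁻¹ * (Δ + σu) = Φ₀ᵀ * Δ⁻¹ * (Δm + σu) := by
    rw [Matrix.mul_add, Matrix.mul_add, Matrix.nonsing_inv_mul_cancel_right _ _ dΔ, ← hΦ,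
      Matrix.nonsing_inv_mul_cancel_right _ _ dm]
  have hinv : (L * (Δm + σu) * Lᵀ)⁻¹
      = Δ⁻¹ * (Δ + σu) * (Δm + σu)⁻¹ * ((Δ + σu) * Δ⁻¹) := by
    rw [hL, Matrix.transpose_mul, Matrix.transpose_nonsing_inv, tΔ, tS]
    simp only [Matrix.mul_inv_rev, Matrix.nonsing_inv_nonsing_inv _ dS, Matrix.mul_assoc]
  have h1 : (Δ + σu) * Δ⁻¹ = 1 + σu * Δ⁻¹ := by
    rw [Matrix.add_mul, Matrix.mul_nonsing_inv _ dΔ]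
  rw [hinv, h1, ← Matrix.mul_assoc, ← Matrix.mul_assoc, ← Matrix.mul_assoc, key,
    Matrix.mul_nonsing_inv_cancel_right _ _ dT]
end

section
/- Let Δ and Σ_x be symmetric positive definite p×p real matrices and Σ_u a symmetric positive semidefinite p×p real matrix, and set L = Δ(Δ + Σ_u)⁻¹ and Σ_w = Σ_x + Σ_u. If Φ₀ is a p×q real matrix such that Φ₀ᵀ Σ_x⁻¹ = Φ₀ᵀ Δ⁻¹, then Φ₀ᵀ (L Σ_w Lᵀ)⁻¹ Φ₀ = Φ₀ᵀ Δ⁻¹ (I_p + Σ_u Δ⁻¹) Φ₀. -/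
open Matrix

/-- Appendix C identity: the quadratic form of the SAVE complement in the inverse of the
marginal covariance of the adjusted surrogate. -/
theorem marginal_quadratic_form_identity {p q : ℕ}
    (Δ : Matrix (Fin p) (Fin p) ℝ) (hΔ : Δ.PosDef)
    (σx : Matrix (Fin p) (Fin p) ℝ) (hσx : σx.PosDef)
    (σu : Matrix (Fin p) (Fin p) ℝ) (hσu : σu.PosSemidef)
    (L : Matrix (Fin p) (Fin p) ℝ) (hL : L = Δ * (Δ + σu)⁻¹)
    (σw : Matrix (Fin p) (Fin p) ℝ) (hσw : σw = σx + σu)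
    (Φ₀ : Matrix (Fin p) (Fin q) ℝ)
    (hΦ : Φ₀ᵀ * σx⁻¹ = Φ₀ᵀ * Δ⁻¹) :
    Φ₀ᵀ * (L * σw * Lᵀ)⁻¹ * Φ₀ = Φ₀ᵀ * Δ⁻¹ * (1 + σu * Δ⁻¹) * Φ₀ := by
  have hS : (Δ + σu).PosDef := hΔ.add_posSemidef hσu
  have hW : (σx + σu).PosDef := hσx.add_posSemidef hσu
  have dΔ : IsUnit Δ.det := (Matrix.isUnit_iff_isUnit_det _).1 hΔ.isUnit
  have dx : IsUnit σx.det := (Matrix.isUnit_iff_isUnit_det _).1 hσx.isUnit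
  have dS : IsUnit (Δ + σu).det := (Matrix.isUnit_iff_isUnit_det _).1 hS.isUnit
  have dW : IsUnit (σx + σu).det := (Matrix.isUnit_iff_isUnit_det _).1 hW.isUnit
  have tΔ : Δᵀ = Δ := by
    have h := hΔ.isHermitian.eq
    rwa [Matrix.conjTranspose_eq_transpose_of_trivial] at h
  have tS : (Δ + σu)ᵀ = Δ + σu := by
    have h := hS.isHermitian.eq
    rwa [Matrix.conjTranspose_eq_transpose_of_trivial] at h
  have key : Φ₀ᵀ * (Δ⁻¹ * (Δ + σu)) = Φ₀ᵀ * Δ⁻¹ * (σx + σu) := by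
    have h1 : Φ₀ᵀ * Δ⁻¹ * σx = Φ₀ᵀ := by
      rw [← hΦ, Matrix.mul_assoc, Matrix.nonsing_inv_mul _ dx, Matrix.mul_one]
    rw [Matrix.mul_add (Φ₀ᵀ * Δ⁻¹), h1, Matrix.mul_add, Matrix.nonsing_inv_mul _ dΔ,
      Matrix.mul_add, Matrix.mul_one, Matrix.mul_assoc]
  have hinv : (L * σw * Lᵀ)⁻¹ = Δ⁻¹ * (Δ + σu) * (σx + σu)⁻¹ * ((Δ + σu) * Δ⁻¹) := by
    rw [hL, hσw, Matrix.transpose_mul, Matrix.transpose_nonsing_inv, tΔ, tS,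
      Matrix.mul_inv_rev, Matrix.mul_inv_rev, Matrix.mul_inv_rev, Matrix.mul_inv_rev,
      Matrix.nonsing_inv_nonsing_inv _ dS]
    simp only [Matrix.mul_assoc]
  have hone : (Δ + σu) * Δ⁻¹ = 1 + σu * Δ⁻¹ := by
    rw [Matrix.add_mul, Matrix.mul_nonsing_inv _ dΔ]
  rw [hinv, hone, ← Matrix.mul_assoc, ← Matrix.mul_assoc, key,
    Matrix.mul_nonsing_inv_cancel_right _ _ dW]
end

section
/- Let Σ_x and Δ_m be symmetric positive definite p×p real matrices and Σ_u a symmetric positive semidefinite p×p real matrix, and set Σ_w = Σ_x + Σ_u, Σ* = Σ_x Σ_w⁻¹ Σ_x, and Δ_m* = Σ_x Σ_w⁻¹ (Δ_m + Σ_u) Σ_w⁻¹ Σ_x. If Φ₀ is a p×q real matrix such that Φ₀ᵀ Σ_x⁻¹ = Φ₀ᵀ Δ_m⁻¹, then Φ₀ᵀ (Δ_m*)⁻¹ Φ₀ = Φ₀ᵀ (Σ*)⁻¹ Φ₀. -/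
open Matrix

/-- Equation (SAVE2) in Appendix C: quadratic forms of the SAVE complement in the inverses of the
within-slice and marginal covariances of the invariance-law adjusted covariate agree. -/
theorem IL_quadratic_form_identity {p q : ℕ}
    (σx : Matrix (Fin p) (Fin p) ℝ) (hσx : σx.PosDef)
    (Δm : Matrix (Fin p) (Fin p) ℝ) (hΔm : Δm.PosDef)
    (σu : Matrix (Fin p) (Fin p) ℝ) (hσu : σu.PosSemidef)
    (σw : Matrix (Fin p) (Fin p) ℝ) (hσw : σw = σx + σu)
    (σstar : Matrix (Fin p) (Fin p) ℝ) (hσstar : σstar = σx * σw⁻¹ * σx)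
    (Δmstar : Matrix (Fin p) (Fin p) ℝ) (hΔmstar : Δmstar = σx * σw⁻¹ * (Δm + σu) * σw⁻¹ * σx)
    (Φ₀ : Matrix (Fin p) (Fin q) ℝ)
    (hΦ : Φ₀ᵀ * σx⁻¹ = Φ₀ᵀ * Δm⁻¹) :
    Φ₀ᵀ * Δmstar⁻¹ * Φ₀ = Φ₀ᵀ * σstar⁻¹ * Φ₀ := by
  have hx : IsUnit σx.det := (Matrix.isUnit_iff_isUnit_det _).1 hσx.isUnit
  have hm : IsUnit Δm.det := (Matrix.isUnit_iff_isUnit_det _).1 hΔm.isUnit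
  have hw : IsUnit σw.det := by
    rw [hσw]
    exact (Matrix.isUnit_iff_isUnit_det _).1 (hσx.add_posSemidef hσu).isUnit
  have hv : IsUnit (Δm + σu).det :=
    (Matrix.isUnit_iff_isUnit_det _).1 (hΔm.add_posSemidef hσu).isUnit
  have h1 : Φ₀ᵀ * σx⁻¹ * σw = Φ₀ᵀ * σx⁻¹ * (Δm + σu) := by
    rw [hσw, Matrix.mul_add, Matrix.mul_add]
    congr 1
    rw [Matrix.nonsing_inv_mul_cancel_right _ _ hx, hΦ,
      Matrix.nonsing_inv_mul_cancel_right _ _ hm]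
  have h2 : Φ₀ᵀ * Δmstar⁻¹ = Φ₀ᵀ * σstar⁻¹ := by
    rw [hΔmstar, hσstar]
    simp only [Matrix.mul_inv_rev, Matrix.nonsing_inv_nonsing_inv _ hw]
    simp only [← Matrix.mul_assoc]
    rw [h1, Matrix.mul_nonsing_inv_cancel_right _ _ hv, h1]
  rw [h2]
end

section
/- Let Δ₁,…,Δ_M be symmetric positive definite p×p real matrices, f₁,…,f_M positive reals with Σ_{m=1}^M f_m = 1, Δ = Σ_{m=1}^M f_m Δ_m, Σ_u symmetric positive semidefinite, Σ_x symmetric positive definite with Σ_x − Δ positive definite, Σ_w = Σ_x + Σ_u, Σ* = Σ_x Σ_w⁻¹ Σ_x, and Δ_m* = Σ_x Σ_w⁻¹ (Δ_m + Σ_u) Σ_w⁻¹ Σ_x. Then for every p×q real matrix Ψ₀ of full column rank q, Σ_{m=1}^M f_m · log det(Ψ₀ᵀ (Δ_m*)⁻¹ Ψ₀) ≥ log det(Ψ₀ᵀ (Σ*)⁻¹ Ψ₀). -/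
open Matrix BigOperators

open scoped MatrixOrder Matrix.Norms.L2Operator in
lemma psd_factor {n : ℕ} {A : Matrix (Fin n) (Fin n) ℝ} (hA : A.PosSemidef) :
    ∃ R : Matrix (Fin n) (Fin n) ℝ, A = Rᵀ * R := by
  obtain ⟨B, hB⟩ := CStarAlgebra.nonneg_iff_eq_star_mul_self.mp hA.nonneg
  exact ⟨B, by simpa [star_eq_conjTranspose] using hB⟩

lemma trace_mul_psd {n : ℕ} {A B : Matrix (Fin n) (Fin n) ℝ} (hA : A.PosSemidef)
    (hB : B.PosSemidef) : 0 ≤ (A * B).trace := by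
  obtain ⟨R, rfl⟩ := psd_factor hB
  have h := (hA.mul_mul_conjTranspose_same R).trace_nonneg
  rw [conjTranspose_eq_transpose_of_trivial, Matrix.mul_assoc, trace_mul_comm,
    Matrix.mul_assoc] at h
  exact h

lemma log_det_le {n : ℕ} {A : Matrix (Fin n) (Fin n) ℝ} (hA : A.PosDef) :
    Real.log A.det ≤ A.trace - n := by
  rw [hA.1.det_eq_prod_eigenvalues, hA.1.trace_eq_sum_eigenvalues]
  simp only [RCLike.ofReal_real_eq_id, id]
  rw [Real.log_prod (fun i _ => (hA.eigenvalues_pos i).ne')]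
  calc _ ≤ ∑ i, (hA.1.eigenvalues i - 1) :=
        Finset.sum_le_sum fun i _ => Real.log_le_sub_one_of_pos (hA.eigenvalues_pos i)
    _ = _ := by simp

lemma log_det_tangent {n : ℕ} {N G : Matrix (Fin n) (Fin n) ℝ} (hN : N.PosDef) (hG : G.PosDef) :
    Real.log G.det + n - (N⁻¹ * G).trace ≤ Real.log N.det := by
  obtain ⟨R, hR⟩ := psd_factor hN.inv.posSemidef
  have hd : N⁻¹.det = R.det * R.det := by rw [hR]; simp
  have hd0 : R.det ≠ 0 := by
    intro h
    have := hN.inv.det_pos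
    rw [hd, h] at this
    simp at this
  have hX : (R * G * Rᵀ).PosDef := by
    have := hG.mul_mul_conjTranspose_same (B := R)
      (Matrix.vecMul_injective_of_isUnit ((Matrix.isUnit_iff_isUnit_det _).2 hd0.isUnit))
    simpa using this
  have h := log_det_le hX
  have h1 : (R * G * Rᵀ).det = N⁻¹.det * G.det := by rw [hd]; simp; ring
  have h2 : (R * G * Rᵀ).trace = (N⁻¹ * G).trace := by
    rw [hR, trace_mul_comm, Matrix.mul_assoc]
  have h3 : N⁻¹.det = (N.det)⁻¹ := by
    rw [Matrix.det_nonsing_inv, Ring.inverse_eq_inv']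
  rw [h1, h2, Real.log_mul hN.inv.det_pos.ne' hG.det_pos.ne', h3, Real.log_inv] at h
  linarith

lemma gauss_markov_s6 {p q : ℕ} {A : Matrix (Fin p) (Fin p) ℝ} (hA : A.PosDef)
    (P : Matrix (Fin p) (Fin q) ℝ) (hN : (Pᵀ * A⁻¹ * P).PosDef)
    (L : Matrix (Fin q) (Fin p) ℝ) (hL : L * P = 1) :
    (L * A * Lᵀ - (Pᵀ * A⁻¹ * P)⁻¹).PosSemidef := by
  set N := Pᵀ * A⁻¹ * P with hNd
  have h := hA.posSemidef.mul_mul_conjTranspose_same (L - N⁻¹ * Pᵀ * A⁻¹)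
  rw [conjTranspose_eq_transpose_of_trivial] at h
  convert h using 1
  have hAT : (A⁻¹)ᵀ = A⁻¹ := by simpa using hA.inv.1.eq
  have hNT : (N⁻¹)ᵀ = N⁻¹ := by simpa using hN.inv.1.eq
  have hAu : IsUnit A.det := hA.det_pos.ne'.isUnit
  have hNu : IsUnit N.det := hN.det_pos.ne'.isUnit
  have hL' : Pᵀ * Lᵀ = 1 := by rw [← transpose_mul, hL, transpose_one]
  have e1 : (N⁻¹ * Pᵀ * A⁻¹) * A = N⁻¹ * Pᵀ := by
    rw [Matrix.mul_assoc, Matrix.nonsing_inv_mul _ hAu, Matrix.mul_one]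
  have e2 : (N⁻¹ * Pᵀ * A⁻¹)ᵀ = A⁻¹ * P * N⁻¹ := by
    simp only [transpose_mul, hAT, hNT, transpose_transpose, Matrix.mul_assoc]
  have e3 : L * A * (A⁻¹ * P * N⁻¹) = N⁻¹ := by
    rw [Matrix.mul_assoc, Matrix.mul_assoc A⁻¹, Matrix.mul_nonsing_inv_cancel_left _ _ hAu,
      ← Matrix.mul_assoc, hL, Matrix.one_mul]
  have e4 : N⁻¹ * Pᵀ * Lᵀ = N⁻¹ := by rw [Matrix.mul_assoc, hL', Matrix.mul_one]
  have e5 : N⁻¹ * Pᵀ * (A⁻¹ * P * N⁻¹) = N⁻¹ := by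
    have : N⁻¹ * Pᵀ * (A⁻¹ * P * N⁻¹) = N⁻¹ * N * N⁻¹ := by
      rw [hNd]; simp only [Matrix.mul_assoc]
    rw [this, Matrix.nonsing_inv_mul _ hNu, Matrix.one_mul]
  rw [transpose_sub, Matrix.sub_mul, e1, e2, Matrix.sub_mul, Matrix.mul_sub, Matrix.mul_sub,
    e3, e4, e5]
  abel

lemma core {p q M : ℕ} (A : Fin M → Matrix (Fin p) (Fin p) ℝ) (hA : ∀ m, (A m).PosDef)
    (f : Fin M → ℝ) (hf : ∀ m, 0 < f m) (hfsum : ∑ m, f m = 1)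
    (S : Matrix (Fin p) (Fin p) ℝ) (hS : S.PosDef) (hSA : (S - ∑ m, f m • A m).PosSemidef)
    (P : Matrix (Fin p) (Fin q) ℝ) (hP : Function.Injective P.mulVec) :
    Real.log ((Pᵀ * S⁻¹ * P).det) ≤ ∑ m, f m * Real.log ((Pᵀ * (A m)⁻¹ * P).det) := by
  have pd : ∀ B : Matrix (Fin p) (Fin p) ℝ, B.PosDef → (Pᵀ * B⁻¹ * P).PosDef := fun B hB => by
    simpa using hB.inv.conjTranspose_mul_mul_same hP
  have hG := pd S hS
  set G := Pᵀ * S⁻¹ * P with hGd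
  have hGu : IsUnit G.det := hG.det_pos.ne'.isUnit
  have hSu : IsUnit S.det := hS.det_pos.ne'.isUnit
  have hGT : (G⁻¹)ᵀ = G⁻¹ := by simpa using hG.inv.1.eq
  have hST : (S⁻¹)ᵀ = S⁻¹ := by simpa using hS.inv.1.eq
  set L := G⁻¹ * Pᵀ * S⁻¹ with hLd
  have hL : L * P = 1 := by
    have : L * P = G⁻¹ * G := by rw [hLd, hGd]; simp only [Matrix.mul_assoc]
    rw [this, Matrix.nonsing_inv_mul _ hGu]
  have hLS : L * S * Lᵀ * G = 1 := by
    have e2 : Lᵀ = S⁻¹ * P * G⁻¹ := by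
      simp only [hLd, transpose_mul, hST, hGT, transpose_transpose, Matrix.mul_assoc]
    rw [e2, Matrix.mul_assoc L, Matrix.mul_assoc S⁻¹, Matrix.mul_nonsing_inv_cancel_left _ _ hSu,
      ← Matrix.mul_assoc L, hL, Matrix.one_mul, Matrix.nonsing_inv_mul _ hGu]
  have step : ∀ m, Real.log G.det + q - (L * A m * Lᵀ * G).trace
      ≤ Real.log ((Pᵀ * (A m)⁻¹ * P).det) := fun m => by
    have h1 := log_det_tangent (pd _ (hA m)) hG
    have h2 := trace_mul_psd (gauss_markov_s6 (hA m) P (pd _ (hA m)) L hL) hG.posSemidef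
    rw [Matrix.sub_mul, trace_sub] at h2
    linarith
  have h3 : 0 ≤ ((L * (S - ∑ m, f m • A m) * Lᵀ) * G).trace := by
    refine trace_mul_psd ?_ hG.posSemidef
    simpa using hSA.mul_mul_conjTranspose_same L
  have h4 : ((L * (S - ∑ m, f m • A m) * Lᵀ) * G).trace
      = q - ∑ m, f m * (L * A m * Lᵀ * G).trace := by
    rw [Matrix.mul_sub, Matrix.sub_mul, Matrix.sub_mul, hLS, trace_sub, trace_one]
    simp [Matrix.mul_sum, Matrix.sum_mul, trace_sum]
  rw [h4] at h3
  calc Real.log G.det ≤ ∑ m, f m * (Real.log G.det + q - (L * A m * Lᵀ * G).trace) := by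
        simp only [mul_sub, Finset.sum_sub_distrib, ← Finset.sum_mul, hfsum]
        linarith
    _ ≤ _ := Finset.sum_le_sum fun m _ => mul_le_mul_of_nonneg_left (step m) (hf m).le

/-- Optimality inequality for the population IL-LAD criterion (Theorem 2, IL-LAD part). -/
theorem ILLAD_population_inequality {p q M : ℕ}
    (Δm : Fin M → Matrix (Fin p) (Fin p) ℝ) (hΔm : ∀ m, (Δm m).PosDef)
    (f : Fin M → ℝ) (hf : ∀ m, 0 < f m) (hfsum : ∑ m, f m = 1)
    (Δ : Matrix (Fin p) (Fin p) ℝ) (hΔ : Δ = ∑ m, f m • Δm m)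
    (σu : Matrix (Fin p) (Fin p) ℝ) (hσu : σu.PosSemidef)
    (σx : Matrix (Fin p) (Fin p) ℝ) (hσx : σx.PosDef)
    (hdiff : (σx - Δ).PosDef)
    (σw : Matrix (Fin p) (Fin p) ℝ) (hσw : σw = σx + σu)
    (σstar : Matrix (Fin p) (Fin p) ℝ) (hσstar : σstar = σx * σw⁻¹ * σx)
    (Δmstar : Fin M → Matrix (Fin p) (Fin p) ℝ)
    (hΔmstar : ∀ m, Δmstar m = σx * σw⁻¹ * (Δm m + σu) * σw⁻¹ * σx)
    (Ψ₀ : Matrix (Fin p) (Fin q) ℝ) (hrank : Ψ₀.rank = q) :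
    ∑ m, f m * Real.log ((Ψ₀ᵀ * (Δmstar m)⁻¹ * Ψ₀).det)
      ≥ Real.log ((Ψ₀ᵀ * σstar⁻¹ * Ψ₀).det) := by
  have hw : σw.PosDef := hσw ▸ hσx.add_posSemidef hσu
  have hwu : IsUnit σw.det := hw.det_pos.ne'.isUnit
  have hxT : σxᵀ = σx := by simpa using hσx.1.eq
  have hwT : (σw⁻¹)ᵀ = σw⁻¹ := by simpa using hw.inv.1.eq
  set B := σx * σw⁻¹ with hB
  have hBT : Bᵀ = σw⁻¹ * σx := by rw [hB, transpose_mul, hxT, hwT]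
  have hBu : IsUnit B := hσx.isUnit.mul hw.inv.isUnit
  have hconj : ∀ C : Matrix (Fin p) (Fin p) ℝ, C.PosDef → (B * C * Bᵀ).PosDef := fun C hC => by
    simpa using hC.mul_mul_conjTranspose_same (Matrix.vecMul_injective_of_isUnit hBu)
  have hAm : ∀ m, Δmstar m = B * (Δm m + σu) * Bᵀ := fun m => by
    rw [hΔmstar, hBT, Matrix.mul_assoc (B * _)]
  have hS : σstar = B * σw * Bᵀ := by
    rw [hσstar, hBT, Matrix.mul_assoc B, Matrix.mul_nonsing_inv_cancel_left _ _ hwu]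
  refine core Δmstar (fun m => ?_) f hf hfsum σstar ?_ ?_ Ψ₀ ?_
  · rw [hAm]
    exact hconj _ ((hΔm m).add_posSemidef hσu)
  · rw [hS]
    exact hconj _ hw
  · have : σstar - ∑ m, f m • Δmstar m = B * (σx - Δ) * Bᵀ := by
      have e : ∑ m, f m • Δmstar m = B * (Δ + σu) * Bᵀ := by
        have : Δ + σu = ∑ m, f m • (Δm m + σu) := by
          simp only [smul_add, Finset.sum_add_distrib, ← Finset.sum_smul, hfsum, one_smul, hΔ]
        rw [this, Matrix.mul_sum, Matrix.sum_mul]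
        refine Finset.sum_congr rfl fun m _ => ?_
        rw [hAm, Matrix.mul_smul, Matrix.smul_mul]
      rw [e, hS, ← Matrix.sub_mul, ← Matrix.mul_sub, hσw]
      congr 2
      abel
    rw [this]
    exact (hconj _ hdiff).posSemidef
  · have h := LinearMap.finrank_range_add_finrank_ker Ψ₀.mulVecLin
    rw [← Matrix.rank, hrank, Module.finrank_fin_fun] at h
    have h0 : LinearMap.ker Ψ₀.mulVecLin = ⊥ := Submodule.finrank_eq_zero.1 (by omega)
    exact LinearMap.ker_eq_bot.1 h0
end

section
/- Let Δ₁,…,Δ_M and Σ_x be symmetric positive definite p×p real matrices, f₁,…,f_M positive reals with Σ_{m=1}^M f_m = 1, Δ = Σ_{m=1}^M f_m Δ_m, Σ_u symmetric positive semidefinite, Σ_w = Σ_x + Σ_u, Σ* = Σ_x Σ_w⁻¹ Σ_x, and Δ_m* = Σ_x Σ_w⁻¹ (Δ_m + Σ_u) Σ_w⁻¹ Σ_x. If Φ₀ is a p×q real matrix of full column rank q such that Φ₀ᵀ Σ_x⁻¹ = Φ₀ᵀ Δ_m⁻¹ for every m = 1,…,M, then Σ_{m=1}^M f_m · log det(Φ₀ᵀ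 (Δ_m*)⁻¹ Φ₀) = log det(Φ₀ᵀ (Σ*)⁻¹ Φ₀). -/
open Matrix BigOperators

/-- Equality case of the IL-LAD population criterion at the SAVE subspace (Theorem 2). -/
theorem ILLAD_equality_at_SAVE {p q M : ℕ}
    (Δm : Fin M → Matrix (Fin p) (Fin p) ℝ) (hΔm : ∀ m, (Δm m).PosDef)
    (σx : Matrix (Fin p) (Fin p) ℝ) (hσx : σx.PosDef)
    (f : Fin M → ℝ) (hf : ∀ m, 0 < f m) (hfsum : ∑ m, f m = 1)
    (Δ : Matrix (Fin p) (Fin p) ℝ) (hΔ : Δ = ∑ m, f m • Δm m)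
    (σu : Matrix (Fin p) (Fin p) ℝ) (hσu : σu.PosSemidef)
    (σw : Matrix (Fin p) (Fin p) ℝ) (hσw : σw = σx + σu)
    (σstar : Matrix (Fin p) (Fin p) ℝ) (hσstar : σstar = σx * σw⁻¹ * σx)
    (Δmstar : Fin M → Matrix (Fin p) (Fin p) ℝ)
    (hΔmstar : ∀ m, Δmstar m = σx * σw⁻¹ * (Δm m + σu) * σw⁻¹ * σx)
    (Φ₀ : Matrix (Fin p) (Fin q) ℝ) (hrank : Φ₀.rank = q)
    (hΦ : ∀ m, Φ₀ᵀ * σx⁻¹ = Φ₀ᵀ * (Δm m)⁻¹) :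
    ∑ m, f m * Real.log ((Φ₀ᵀ * (Δmstar m)⁻¹ * Φ₀).det)
      = Real.log ((Φ₀ᵀ * σstar⁻¹ * Φ₀).det) := by
  have hX : IsUnit σx.det := (isUnit_iff_isUnit_det _).1 hσx.isUnit
  have hW : IsUnit σw.det := by
    rw [hσw]; exact (isUnit_iff_isUnit_det _).1 (hσx.add_posSemidef hσu).isUnit
  have key : ∀ m, Φ₀ᵀ * (Δmstar m)⁻¹ * Φ₀ = Φ₀ᵀ * σstar⁻¹ * Φ₀ := by
    intro m
    have hD : IsUnit (Δm m).det := (isUnit_iff_isUnit_det _).1 (hΔm m).isUnit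
    have hS : IsUnit (Δm m + σu).det :=
      (isUnit_iff_isUnit_det _).1 ((hΔm m).add_posSemidef hσu).isUnit
    have h1 : Φ₀ᵀ * σx⁻¹ * σw = Φ₀ᵀ * σx⁻¹ * (Δm m + σu) := by
      rw [hσw, Matrix.mul_add, Matrix.mul_add, nonsing_inv_mul_cancel_right _ _ hX, hΦ m,
        nonsing_inv_mul_cancel_right _ _ hD]
    have h2 : Φ₀ᵀ * σx⁻¹ * σw * (Δm m + σu)⁻¹ = Φ₀ᵀ * σx⁻¹ := by
      rw [h1, mul_nonsing_inv_cancel_right _ _ hS]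
    have e1 : (Δmstar m)⁻¹ = σx⁻¹ * (σw * ((Δm m + σu)⁻¹ * (σw * σx⁻¹))) := by
      rw [hΔmstar m]
      simp only [Matrix.mul_inv_rev, nonsing_inv_nonsing_inv _ hW, Matrix.mul_assoc]
    have e2 : σstar⁻¹ = σx⁻¹ * (σw * σx⁻¹) := by
      rw [hσstar]
      simp only [Matrix.mul_inv_rev, nonsing_inv_nonsing_inv _ hW]
    rw [e1, e2]
    simp only [← Matrix.mul_assoc]
    rw [h2]
  simp only [key]
  rw [← Finset.sum_mul, hfsum, one_mul]
end

section
/- Let Q₁,…,Q_M be symmetric positive definite p×p real matrices and f₁,…,f_M nonnegative reals with Σ_{m=1}^M f_m = 1. Then for every p×q real matrix Ψ₀ of full column rank q, Σ_{m=1}^M f_m · log det(Ψ₀ᵀ Q_m⁻¹ Ψ₀) ≥ log det(Ψ₀ᵀ (Σ_{m=1}^M f_m Q_m)⁻¹ Ψ₀). -/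
open Matrix BigOperators

lemma aux_logdet {q : ℕ} (A : Matrix (Fin q) (Fin q) ℝ) (hA : A.PosDef) :
    Real.log A.det ≤ A.trace - q := by
  have h1 := hA.1.det_eq_prod_eigenvalues
  have h2 := hA.1.trace_eq_sum_eigenvalues
  simp only [RCLike.ofReal_real_eq_id, id] at h1 h2
  rw [h1, h2, Real.log_prod (fun i _ => (hA.eigenvalues_pos i).ne')]
  have : ∑ i, Real.log (hA.1.eigenvalues i) ≤ ∑ i, (hA.1.eigenvalues i - 1) :=
    Finset.sum_le_sum fun i _ => Real.log_le_sub_one_of_pos (hA.eigenvalues_pos i)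
  simpa [Finset.sum_sub_distrib] using this

lemma aux_inj {p q : ℕ} (Ψ : Matrix (Fin p) (Fin q) ℝ) (h : Ψ.rank = q) :
    Function.Injective Ψ.mulVec := by
  have h1 := LinearMap.finrank_range_add_finrank_ker Ψ.mulVecLin
  have h2 : Module.finrank ℝ (LinearMap.range Ψ.mulVecLin) = q := h
  rw [h2] at h1
  simp only [Module.finrank_fintype_fun_eq_card, Fintype.card_fin] at h1
  have h3 : Module.finrank ℝ (LinearMap.ker Ψ.mulVecLin) = 0 := by omega
  have h4 := Submodule.finrank_eq_zero.mp h3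
  exact LinearMap.ker_eq_bot.mp h4

lemma aux_pd {p q : ℕ} (Ψ : Matrix (Fin p) (Fin q) ℝ) (h : Ψ.rank = q)
    (Q : Matrix (Fin p) (Fin p) ℝ) (hQ : Q.PosDef) : (Ψᵀ * Q⁻¹ * Ψ).PosDef := by
  have := hQ.inv.conjTranspose_mul_mul_same (aux_inj Ψ h)
  simpa [conjTranspose_eq_transpose_of_trivial] using this

lemma aux_sum {p M : ℕ} 
    (Q : Fin M → Matrix (Fin p) (Fin p) ℝ) (hQ : ∀ m, (Q m).PosDef)
    (f : Fin M → ℝ) (hf : ∀ m, 0 ≤ f m) (hfsum : ∑ m, f m = 1) :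
    (∑ m, f m • Q m).PosDef := by
  obtain ⟨m, hm⟩ : ∃ m, 0 < f m := by
    by_contra! hc
    have := Finset.sum_nonpos (s := Finset.univ) (fun i _ => hc i)
    linarith
  rw [← Finset.add_sum_erase _ _ (Finset.mem_univ m)]
  exact ((hQ m).smul hm).add_posSemidef
    (posSemidef_sum _ fun i _ => (hQ i).posSemidef.smul (hf i))

/-- Gauss-Markov bound -/
lemma aux_gm {p q : ℕ} (Ψ L : Matrix (Fin p) (Fin q) ℝ) (h : Ψ.rank = q)
    (Q : Matrix (Fin p) (Fin p) ℝ) (hQ : Q.PosDef) (hL : Lᵀ * Ψ = 1) :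
    (Lᵀ * Q * L - (Ψᵀ * Q⁻¹ * Ψ)⁻¹).PosSemidef := by
  have hG := aux_pd Ψ h Q hQ
  set G := Ψᵀ * Q⁻¹ * Ψ with hGdef
  have hQt : Qᵀ = Q := hQ.1
  have hGt : Gᵀ = G := hG.1
  have hQu : IsUnit Q.det := (Matrix.isUnit_iff_isUnit_det _).mp hQ.isUnit
  have hGu : IsUnit G.det := (Matrix.isUnit_iff_isUnit_det _).mp hG.isUnit
  have hL' : Ψᵀ * L = 1 := by
    have := congrArg transpose hL
    simpa using this
  have := hQ.posSemidef.conjTranspose_mul_mul_same (L - Q⁻¹ * Ψ * G⁻¹)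
  convert this using 1
  rw [conjTranspose_eq_transpose_of_trivial]
  simp only [transpose_sub, transpose_mul, transpose_nonsing_inv, hQt, hGt]
  have e1 : Lᵀ * Q * (Q⁻¹ * Ψ * G⁻¹) = G⁻¹ := by
    calc _ = Lᵀ * (Q * Q⁻¹) * Ψ * G⁻¹ := by simp only [Matrix.mul_assoc]
      _ = _ := by rw [mul_nonsing_inv _ hQu, Matrix.mul_one, hL, Matrix.one_mul]
  have e2 : G⁻¹ * (Ψᵀ * Q⁻¹) * Q * L = G⁻¹ := by
    calc _ = G⁻¹ * (Ψᵀ * (Q⁻¹ * Q) * L) := by simp only [Matrix.mul_assoc]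
      _ = _ := by rw [nonsing_inv_mul _ hQu, Matrix.mul_one, hL', Matrix.mul_one]
  have e3 : G⁻¹ * (Ψᵀ * Q⁻¹) * Q * (Q⁻¹ * Ψ * G⁻¹) = G⁻¹ := by
    calc _ = G⁻¹ * (Ψᵀ * (Q⁻¹ * Q) * Q⁻¹ * Ψ) * G⁻¹ := by simp only [Matrix.mul_assoc]
      _ = _ := by
        rw [nonsing_inv_mul _ hQu, Matrix.mul_one, ← hGdef, nonsing_inv_mul _ hGu, Matrix.one_mul]
  rw [Matrix.sub_mul, Matrix.sub_mul, Matrix.mul_sub, Matrix.mul_sub, e1, e2, e3]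
  abel

/-- Supporting hyperplane -/
lemma aux_tangent {p q : ℕ} (Ψ L : Matrix (Fin p) (Fin q) ℝ) (h : Ψ.rank = q)
    (Q : Matrix (Fin p) (Fin p) ℝ) (hQ : Q.PosDef) (hL : Lᵀ * Ψ = 1)
    (S : Matrix (Fin q) (Fin q) ℝ) (hS : S.PosDef) :
    Real.log S.det - Real.log (Ψᵀ * Q⁻¹ * Ψ).det ≤ (S * (Lᵀ * Q * L)).trace - q := by
  have hG := aux_pd Ψ h Q hQ
  have hgm := aux_gm Ψ L h Q hQ hL
  set G := Ψᵀ * Q⁻¹ * Ψ with hGdef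
  obtain ⟨B, hB⟩ : ∃ B : Matrix (Fin q) (Fin q) ℝ, S = Bᵀ * B := by
    open scoped MatrixOrder in
    obtain ⟨B, hB⟩ := CStarAlgebra.nonneg_iff_eq_star_mul_self.mp hS.posSemidef.nonneg
    exact ⟨B, hB⟩
  have hdS : S.det = B.det * B.det := by rw [hB, det_mul, det_transpose]
  have hBu : IsUnit B := by
    rw [Matrix.isUnit_iff_isUnit_det, isUnit_iff_ne_zero]
    intro h0
    have := hS.det_pos
    rw [hdS, h0] at this
    simp at this
  have hA : (B * G⁻¹ * Bᵀ).PosDef := by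
    have := (Matrix.IsUnit.posDef_star_right_conjugate_iff hBu).mpr hG.inv
    exact this
  have h1 := aux_logdet _ hA
  have h2 := (hgm.mul_mul_conjTranspose_same B).trace_nonneg
  rw [conjTranspose_eq_transpose_of_trivial, Matrix.mul_sub, Matrix.sub_mul, trace_sub] at h2
  have h3 : (B * (Lᵀ * Q * L) * Bᵀ).trace = (S * (Lᵀ * Q * L)).trace := by
    rw [trace_mul_comm, ← Matrix.mul_assoc, ← hB]
  have h4 : (B * G⁻¹ * Bᵀ).det = S.det / G.det := by
    rw [det_mul, det_mul, det_transpose, det_nonsing_inv, Ring.inverse_eq_inv', hdS]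
    ring
  rw [h4, Real.log_div hS.det_pos.ne' hG.det_pos.ne'] at h1
  linarith

/-- Jensen-type inequality: finite-convex-combination form of the convexity of
Q ↦ log det(Ψ₀ᵀ Q⁻¹ Ψ₀) on positive definite matrices. -/
theorem logdet_inverse_quadform_jensen {p q M : ℕ}
    (Q : Fin M → Matrix (Fin p) (Fin p) ℝ) (hQ : ∀ m, (Q m).PosDef)
    (f : Fin M → ℝ) (hf : ∀ m, 0 ≤ f m) (hfsum : ∑ m, f m = 1)
    (Ψ₀ : Matrix (Fin p) (Fin q) ℝ) (hrank : Ψ₀.rank = q) :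
    ∑ m, f m * Real.log ((Ψ₀ᵀ * (Q m)⁻¹ * Ψ₀).det)
      ≥ Real.log ((Ψ₀ᵀ * (∑ m, f m • Q m)⁻¹ * Ψ₀).det) := by
  have hR := aux_sum Q hQ f hf hfsum
  set R := ∑ m, f m • Q m with hRdef
  have hS := aux_pd Ψ₀ hrank R hR
  set S := Ψ₀ᵀ * R⁻¹ * Ψ₀ with hSdef
  have hRt : Rᵀ = R := hR.1
  have hSt : Sᵀ = S := hS.1
  have hRu : IsUnit R.det := (Matrix.isUnit_iff_isUnit_det _).mp hR.isUnit
  have hSu : IsUnit S.det := (Matrix.isUnit_iff_isUnit_det _).mp hS.isUnit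
  obtain ⟨L, hLdef⟩ : ∃ L, L = R⁻¹ * Ψ₀ * S⁻¹ := ⟨_, rfl⟩
  have hLt : Lᵀ = S⁻¹ * (Ψ₀ᵀ * R⁻¹) := by
    rw [hLdef]; simp only [transpose_mul, transpose_nonsing_inv, hRt, hSt]
  have hL : Lᵀ * Ψ₀ = 1 := by
    rw [hLt, Matrix.mul_assoc, ← hSdef, nonsing_inv_mul _ hSu]
  have hLR : S * (Lᵀ * R * L) = 1 := by
    have : R * L = Ψ₀ * S⁻¹ := by
      rw [hLdef, ← Matrix.mul_assoc, ← Matrix.mul_assoc, mul_nonsing_inv _ hRu, Matrix.one_mul]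
    rw [Matrix.mul_assoc Lᵀ, this, ← Matrix.mul_assoc Lᵀ, hL, Matrix.one_mul, mul_nonsing_inv _ hSu]
  have key : ∑ m, f m * (Real.log S.det - Real.log (Ψ₀ᵀ * (Q m)⁻¹ * Ψ₀).det)
      ≤ ∑ m, f m * ((S * (Lᵀ * Q m * L)).trace - q) :=
    Finset.sum_le_sum fun m _ => mul_le_mul_of_nonneg_left
      (aux_tangent Ψ₀ L hrank (Q m) (hQ m) hL S hS) (hf m)
  have htr : ∑ m, f m * (S * (Lᵀ * Q m * L)).trace = q := by
    have : (S * (Lᵀ * R * L)).trace = q := by rw [hLR]; simp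
    rw [← this, hRdef]
    simp [Matrix.mul_sum, Matrix.sum_mul, trace_sum]
  simp only [mul_sub, Finset.sum_sub_distrib, ← Finset.sum_mul, hfsum, htr, one_mul] at key
  linarith
end

section
/- Let Δ and Δ_y be symmetric positive definite p×p real matrices and Σ_u a symmetric positive semidefinite p×p real matrix, and set L = Δ(Δ + Σ_u)⁻¹ and G_y = L(Δ_y + Σ_u)Lᵀ. Let (Ψ, Ψ₀) form a p×p orthogonal matrix, i.e., Ψ ∈ ℝ^{p×d} and Ψ₀ ∈ ℝ^{p×(p−d)} satisfy ΨᵀΨ = I_d, Ψ₀ᵀΨ₀ = I_{p−d}, ΨᵀΨ₀ = 0, and ΨΨᵀ + Ψ₀Ψ₀ᵀ = I_p. If Ψ₀ᵀ Δ_y⁻¹ = Ψ₀ᵀ Δ⁻¹, then (Ψ₀ᵀ G_y Ψ)(Ψᵀ G_y Ψ)⁻¹ = (Ψ₀ᵀ L Δ Ψ)(Ψᵀ L Δ Ψ)⁻¹. In particular, the left-hand side does not depend on Δ_y. -/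
open Matrix

/-- Core of Proposition 1: the conditional regression coefficient of Ψ₀ᵀV on ΨᵀV
(with V = LW) does not depend on the slice y. -/
theorem prop1_regression_coefficient {p d : ℕ}
    (Δ : Matrix (Fin p) (Fin p) ℝ) (hΔ : Δ.PosDef)
    (Δy : Matrix (Fin p) (Fin p) ℝ) (hΔy : Δy.PosDef)
    (σu : Matrix (Fin p) (Fin p) ℝ) (hσu : σu.PosSemidef)
    (L : Matrix (Fin p) (Fin p) ℝ) (hL : L = Δ * (Δ + σu)⁻¹)
    (G : Matrix (Fin p) (Fin p) ℝ) (hG : G = L * (Δy + σu) * Lᵀ)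
    (Ψ : Matrix (Fin p) (Fin d) ℝ) (Ψ₀ : Matrix (Fin p) (Fin (p - d)) ℝ)
    (hΨΨ : Ψᵀ * Ψ = 1) (hΨ₀Ψ₀ : Ψ₀ᵀ * Ψ₀ = 1) (hΨΨ₀ : Ψᵀ * Ψ₀ = 0)
    (hcomplete : Ψ * Ψᵀ + Ψ₀ * Ψ₀ᵀ = 1)
    (hΨ₀Δy : Ψ₀ᵀ * Δy⁻¹ = Ψ₀ᵀ * Δ⁻¹) :
    (Ψ₀ᵀ * G * Ψ) * (Ψᵀ * G * Ψ)⁻¹ = (Ψ₀ᵀ * L * Δ * Ψ) * (Ψᵀ * L * Δ * Ψ)⁻¹ := by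
  have hS : (Δ + σu).PosDef := hΔ.add_posSemidef hσu
  have hSy : (Δy + σu).PosDef := hΔy.add_posSemidef hσu
  have uΔ : IsUnit Δ.det := (Matrix.isUnit_iff_isUnit_det _).1 hΔ.isUnit
  have uΔy : IsUnit Δy.det := (Matrix.isUnit_iff_isUnit_det _).1 hΔy.isUnit
  have uS : IsUnit (Δ + σu).det := (Matrix.isUnit_iff_isUnit_det _).1 hS.isUnit
  have tΔ : Δᵀ = Δ := by simpa [Matrix.IsHermitian, conjTranspose_eq_transpose_of_trivial] using hΔ.isHermitian
  have tS : (Δ + σu)ᵀ = Δ + σu := by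
    have := hS.isHermitian
    rwa [Matrix.IsHermitian, conjTranspose_eq_transpose_of_trivial] at this
  have hLT : Lᵀ = (Δ + σu)⁻¹ * Δ := by
    rw [hL, transpose_mul, transpose_nonsing_inv, tS, tΔ]
  have key : ∀ (M : Matrix (Fin p) (Fin p) ℝ) (k : ℕ) (A : Matrix (Fin p) (Fin k) ℝ)
      (B : Matrix (Fin k) (Fin p) ℝ), M.PosDef → B * A = 1 → (Aᵀ * M * A).PosDef := by
    intro M k A B hM hA
    have hinj : Function.Injective A.mulVec := by
      intro x y hxy
      have := congrArg (B.mulVec) hxy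
      simpa [Matrix.mulVec_mulVec, hA] using this
    simpa [conjTranspose_eq_transpose_of_trivial] using hM.conjTranspose_mul_mul_same hinj
  have hLD : L * Δ = Δᵀ * (Δ + σu)⁻¹ * Δ := by rw [hL, tΔ]
  have hH : (L * Δ).PosDef := by
    rw [hLD]
    exact key _ _ _ Δ⁻¹ hS.inv (nonsing_inv_mul _ uΔ)
  have hLinv : (Δ⁻¹ * (Δ + σu)) * Lᵀ = 1 := by
    rw [hLT, Matrix.mul_assoc, mul_nonsing_inv_cancel_left _ _ uS, nonsing_inv_mul _ uΔ]
  have hGp : G.PosDef := by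
    rw [hG]
    have := key _ _ Lᵀ (Δ⁻¹ * (Δ + σu)) hSy hLinv
    simpa using this
  have uG : IsUnit (Ψᵀ * G * Ψ).det :=
    (Matrix.isUnit_iff_isUnit_det _).1 (key _ _ Ψ Ψᵀ hGp hΨΨ).isUnit
  have uH : IsUnit (Ψᵀ * (L * Δ) * Ψ).det :=
    (Matrix.isUnit_iff_isUnit_det _).1 (key _ _ Ψ Ψᵀ hH hΨΨ).isUnit
  have uHH : IsUnit (L * Δ).det := (Matrix.isUnit_iff_isUnit_det _).1 hH.isUnit
  have h0 : Ψ₀ᵀ * Ψ = 0 := by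
    have := congrArg transpose hΨΨ₀
    simpa using this
  have h1 : Ψ₀ᵀ * Δ⁻¹ * (Δy + σu) = Ψ₀ᵀ * Δ⁻¹ * (Δ + σu) := by
    rw [Matrix.mul_add, Matrix.mul_add, ← hΨ₀Δy, nonsing_inv_mul_cancel_right _ _ uΔy, hΨ₀Δy,
      nonsing_inv_mul_cancel_right _ _ uΔ]
  have hΨG : Ψ₀ᵀ * ((L * Δ)⁻¹ * G) * Ψ = 0 := by
    have e : (L * Δ)⁻¹ * G = Δ⁻¹ * (Δy + σu) * Lᵀ := by
      have : G = (L * Δ) * (Δ⁻¹ * (Δy + σu) * Lᵀ) := by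
        rw [hG]
        simp only [Matrix.mul_assoc]
        rw [mul_nonsing_inv_cancel_left _ _ uΔ]
      rw [this, nonsing_inv_mul_cancel_left _ _ uHH]
    rw [e, ← Matrix.mul_assoc, ← Matrix.mul_assoc, h1, Matrix.mul_assoc Ψ₀ᵀ, Matrix.mul_assoc Ψ₀ᵀ,
      hLinv, Matrix.mul_one, h0]
  rw [Matrix.mul_assoc Ψ₀ᵀ L, Matrix.mul_assoc Ψᵀ L]
  generalize L * Δ = H at *
  obtain ⟨B, hB⟩ : ∃ B, B = (Ψ₀ᵀ * H * Ψ) * (Ψᵀ * H * Ψ)⁻¹ := ⟨_, rfl⟩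
  rw [← hB]
  have hz : (Ψ₀ᵀ - B * Ψᵀ) * H * Ψ = 0 := by
    have : B * (Ψᵀ * H * Ψ) = Ψ₀ᵀ * H * Ψ := by
      rw [hB, nonsing_inv_mul_cancel_right _ _ uH]
    rw [Matrix.sub_mul, Matrix.sub_mul, ← this]
    simp only [Matrix.mul_assoc, sub_self]
  have hC : (Ψ₀ᵀ - B * Ψᵀ) * H = ((Ψ₀ᵀ - B * Ψᵀ) * H * Ψ₀) * Ψ₀ᵀ := by
    calc (Ψ₀ᵀ - B * Ψᵀ) * H = (Ψ₀ᵀ - B * Ψᵀ) * H * (Ψ * Ψᵀ + Ψ₀ * Ψ₀ᵀ) := by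
          rw [hcomplete, Matrix.mul_one]
      _ = _ := by
          rw [Matrix.mul_add, ← Matrix.mul_assoc, hz, Matrix.zero_mul, zero_add, Matrix.mul_assoc _ Ψ₀]
  have hfin : (Ψ₀ᵀ - B * Ψᵀ) * G * Ψ = 0 := by
    calc (Ψ₀ᵀ - B * Ψᵀ) * G * Ψ = (Ψ₀ᵀ - B * Ψᵀ) * H * (H⁻¹ * G) * Ψ := by
          rw [Matrix.mul_assoc _ H, mul_nonsing_inv_cancel_left _ _ uHH]
      _ = ((Ψ₀ᵀ - B * Ψᵀ) * H * Ψ₀) * (Ψ₀ᵀ * (H⁻¹ * G) * Ψ) := by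
          generalize H⁻¹ * G = K
          have := congrArg (fun X => X * K * Ψ) hC
          simpa only [Matrix.mul_assoc] using this
      _ = 0 := by rw [hΨG, Matrix.mul_zero]
  rw [Matrix.sub_mul, Matrix.sub_mul, sub_eq_zero] at hfin
  rw [hfin, Matrix.mul_assoc B, Matrix.mul_assoc B, mul_nonsing_inv_cancel_right _ _ uG]
end

section
/- Let Δ and Δ_y be symmetric positive definite p×p real matrices and Σ_u a symmetric positive semidefinite p×p real matrix, and set L = Δ(Δ + Σ_u)⁻¹ and G_y = L(Δ_y + Σ_u)Lᵀ. If Ψ₀ is a p×q real matrix such that Ψ₀ᵀ Δ_y⁻¹ = Ψ₀ᵀ Δ⁻¹, then Ψ₀ᵀ G_y⁻¹ = Ψ₀ᵀ Δ⁻¹ L⁻¹. -/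
open Matrix

/-- Appendix A identity in the proof of Proposition 1: Ψ₀ᵀ G_y⁻¹ = Ψ₀ᵀ Δ⁻¹ L⁻¹. -/
theorem prop1_inverse_identity {p q : ℕ}
    (Δ : Matrix (Fin p) (Fin p) ℝ) (hΔ : Δ.PosDef)
    (Δy : Matrix (Fin p) (Fin p) ℝ) (hΔy : Δy.PosDef)
    (σu : Matrix (Fin p) (Fin p) ℝ) (hσu : σu.PosSemidef)
    (L : Matrix (Fin p) (Fin p) ℝ) (hL : L = Δ * (Δ + σu)⁻¹)
    (G : Matrix (Fin p) (Fin p) ℝ) (hG : G = L * (Δy + σu) * Lᵀ)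
    (Ψ₀ : Matrix (Fin p) (Fin q) ℝ)
    (hΨ₀Δy : Ψ₀ᵀ * Δy⁻¹ = Ψ₀ᵀ * Δ⁻¹) :
    Ψ₀ᵀ * G⁻¹ = Ψ₀ᵀ * Δ⁻¹ * L⁻¹ := by
  have uΔ : IsUnit Δ.det := (Matrix.isUnit_iff_isUnit_det _).1 hΔ.isUnit
  have uΔy : IsUnit Δy.det := (Matrix.isUnit_iff_isUnit_det _).1 hΔy.isUnit
  have uS : IsUnit (Δ + σu).det :=
    (Matrix.isUnit_iff_isUnit_det _).1 (hΔ.add_posSemidef hσu).isUnit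
  have uSy : IsUnit (Δy + σu).det :=
    (Matrix.isUnit_iff_isUnit_det _).1 (hΔy.add_posSemidef hσu).isUnit
  have tΔ : Δᵀ = Δ := by
    have h := hΔ.isHermitian.eq
    rwa [Matrix.conjTranspose_eq_transpose_of_trivial] at h
  have tσ : σuᵀ = σu := by
    have h := hσu.isHermitian.eq
    rwa [Matrix.conjTranspose_eq_transpose_of_trivial] at h
  have hLt : (Lᵀ)⁻¹ = Δ⁻¹ * (Δ + σu) := by
    rw [hL, Matrix.transpose_mul, Matrix.transpose_nonsing_inv, Matrix.transpose_add, tΔ, tσ,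
      Matrix.mul_inv_rev, Matrix.nonsing_inv_nonsing_inv _ uS]
  have key : Ψ₀ᵀ * (Δ⁻¹ * (Δ + σu)) = Ψ₀ᵀ * Δ⁻¹ * (Δy + σu) := by
    rw [← Matrix.mul_assoc, Matrix.mul_add, Matrix.mul_add,
      Matrix.nonsing_inv_mul_cancel_right _ _ uΔ, ← hΨ₀Δy,
      Matrix.nonsing_inv_mul_cancel_right _ _ uΔy]
  rw [hG, Matrix.mul_inv_rev, Matrix.mul_inv_rev, hLt, ← Matrix.mul_assoc, key,
    ← Matrix.mul_assoc, Matrix.mul_nonsing_inv_cancel_right _ _ uSy]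
end

section
/- Let Δ and Δ_y be symmetric positive definite p×p real matrices and Σ_u a symmetric positive semidefinite p×p real matrix, and set L = Δ(Δ + Σ_u)⁻¹ and G_y = L(Δ_y + Σ_u)Lᵀ. Let (Ψ, Ψ₀) form a p×p orthogonal matrix, i.e., Ψ ∈ ℝ^{p×d} and Ψ₀ ∈ ℝ^{p×(p−d)} satisfy ΨᵀΨ = I_d, Ψ₀ᵀΨ₀ = I_{p−d}, ΨᵀΨ₀ = 0, and ΨΨᵀ + Ψ₀Ψ₀ᵀ = I_p. If Ψ₀ᵀ Δ_y⁻¹ = Ψ₀ᵀ Δ⁻¹, then Ψ₀ᵀ G_y Ψ₀ − (Ψ₀ᵀ G_y Ψ)(Ψᵀ G_y Ψ)⁻¹(Ψᵀ G_y Ψ₀) = (Ψ₀ᵀ Δ⁻¹ L⁻¹ Ψ₀)⁻¹. In particular, this Schur complement does not depend on Δ_y. -/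
open Matrix

/-- Part (ii) of Proposition 1: the conditional covariance (Schur complement) of Ψ₀ᵀV given
ΨᵀV does not depend on the slice y. -/
theorem prop1_schur_complement {p d : ℕ}
    (Δ : Matrix (Fin p) (Fin p) ℝ) (hΔ : Δ.PosDef)
    (Δy : Matrix (Fin p) (Fin p) ℝ) (hΔy : Δy.PosDef)
    (σu : Matrix (Fin p) (Fin p) ℝ) (hσu : σu.PosSemidef)
    (L : Matrix (Fin p) (Fin p) ℝ) (hL : L = Δ * (Δ + σu)⁻¹)
    (G : Matrix (Fin p) (Fin p) ℝ) (hG : G = L * (Δy + σu) * Lᵀ)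
    (Ψ : Matrix (Fin p) (Fin d) ℝ) (Ψ₀ : Matrix (Fin p) (Fin (p - d)) ℝ)
    (hΨΨ : Ψᵀ * Ψ = 1) (hΨ₀Ψ₀ : Ψ₀ᵀ * Ψ₀ = 1) (hΨΨ₀ : Ψᵀ * Ψ₀ = 0)
    (hcomplete : Ψ * Ψᵀ + Ψ₀ * Ψ₀ᵀ = 1)
    (hΨ₀Δy : Ψ₀ᵀ * Δy⁻¹ = Ψ₀ᵀ * Δ⁻¹) :
    Ψ₀ᵀ * G * Ψ₀ - (Ψ₀ᵀ * G * Ψ) * (Ψᵀ * G * Ψ)⁻¹ * (Ψᵀ * G * Ψ₀)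
      = (Ψ₀ᵀ * Δ⁻¹ * L⁻¹ * Ψ₀)⁻¹ := by
  have hT : (Δ + σu).PosDef := hΔ.add_posSemidef hσu
  have hTy : (Δy + σu).PosDef := hΔy.add_posSemidef hσu
  have uΔ : IsUnit Δ.det := (Matrix.isUnit_iff_isUnit_det _).1 hΔ.isUnit
  have uΔy : IsUnit Δy.det := (Matrix.isUnit_iff_isUnit_det _).1 hΔy.isUnit
  have uT : IsUnit (Δ + σu).det := (Matrix.isUnit_iff_isUnit_det _).1 hT.isUnit
  have uL' : IsUnit L := by
    rw [hL]
    exact hΔ.isUnit.mul hT.inv.isUnit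
  have uL : IsUnit L.det := (Matrix.isUnit_iff_isUnit_det _).1 uL'
  have sΔ : Δᵀ = Δ := by simpa using hΔ.isHermitian.eq
  have sT : (Δ + σu)ᵀ = Δ + σu := by
    have h := hT.isHermitian.eq
    rwa [Matrix.conjTranspose_eq_transpose_of_trivial] at h
  have hLt : Lᵀ = (Δ + σu)⁻¹ * Δ := by
    rw [hL, Matrix.transpose_mul, Matrix.transpose_nonsing_inv, sT, sΔ]
  have hGp : G.PosDef := by
    have h := hTy.mul_mul_conjTranspose_same (B := L)
      (Matrix.vecMul_injective_iff_isUnit.2 uL')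
    rwa [Matrix.conjTranspose_eq_transpose_of_trivial, ← hG] at h
  have hA : (Ψᵀ * G * Ψ).PosDef := by
    have hinj : Function.Injective Ψ.mulVec := by
      intro x y hxy
      have h := congrArg (fun v => Ψᵀ *ᵥ v) hxy
      simpa [Matrix.mulVec_mulVec, hΨΨ] using h
    have h := hGp.conjTranspose_mul_mul_same (B := Ψ) hinj
    rwa [Matrix.conjTranspose_eq_transpose_of_trivial] at h
  have uA : IsUnit (Ψᵀ * G * Ψ).det := (Matrix.isUnit_iff_isUnit_det _).1 hA.isUnit
  have hΨ₀Ψ : Ψ₀ᵀ * Ψ = 0 := by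
    have h := congrArg Matrix.transpose hΨΨ₀
    simpa [Matrix.transpose_mul] using h
  obtain ⟨K, hK⟩ : ∃ K, K = Ψ₀ᵀ * Δ⁻¹ * L⁻¹ := ⟨_, rfl⟩
  have e : Ψ₀ᵀ * Δ⁻¹ * (Δy + σu) = Ψ₀ᵀ * Δ⁻¹ * (Δ + σu) := by
    rw [Matrix.mul_add, Matrix.mul_add, Matrix.nonsing_inv_mul_cancel_right _ _ uΔ, ← hΨ₀Δy,
      Matrix.nonsing_inv_mul_cancel_right _ _ uΔy]
  have hKG : K * G = Ψ₀ᵀ := by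
    calc K * G = (Ψ₀ᵀ * Δ⁻¹ * L⁻¹ * L) * (Δy + σu) * Lᵀ := by
          rw [hK, hG]; simp only [Matrix.mul_assoc]
      _ = Ψ₀ᵀ * Δ⁻¹ * (Δ + σu) * (Δ + σu)⁻¹ * Δ := by
          rw [Matrix.nonsing_inv_mul_cancel_right _ _ uL, e, hLt, ← Matrix.mul_assoc]
      _ = Ψ₀ᵀ := by
          rw [Matrix.mul_nonsing_inv_cancel_right _ _ uT,
            Matrix.nonsing_inv_mul_cancel_right _ _ uΔ]
  have hP : Ψ₀ * Ψ₀ᵀ = 1 - Ψ * Ψᵀ := eq_sub_of_add_eq' hcomplete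
  have key : K * Ψ₀ * (Ψ₀ᵀ * G) = Ψ₀ᵀ - K * Ψ * (Ψᵀ * G) := by
    calc K * Ψ₀ * (Ψ₀ᵀ * G) = K * (Ψ₀ * Ψ₀ᵀ) * G := by simp only [Matrix.mul_assoc]
      _ = K * G - K * Ψ * (Ψᵀ * G) := by
          rw [hP]; simp only [Matrix.mul_sub, Matrix.sub_mul, Matrix.mul_one, Matrix.mul_assoc]
      _ = _ := by rw [hKG]
  rw [← hK]
  symm
  apply Matrix.inv_eq_right_inv
  have k1 : K * Ψ₀ * (Ψ₀ᵀ * G * Ψ₀) = 1 - K * Ψ * (Ψᵀ * G * Ψ₀) := by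
    rw [← Matrix.mul_assoc, key, Matrix.sub_mul, hΨ₀Ψ₀, Matrix.mul_assoc (K * Ψ)]
  have k2 : K * Ψ₀ * (Ψ₀ᵀ * G * Ψ) = - (K * Ψ * (Ψᵀ * G * Ψ)) := by
    rw [← Matrix.mul_assoc, key, Matrix.sub_mul, hΨ₀Ψ, Matrix.mul_assoc (K * Ψ), zero_sub]
  rw [Matrix.mul_sub, k1, ← Matrix.mul_assoc (K * Ψ₀) (Ψ₀ᵀ * G * Ψ * (Ψᵀ * G * Ψ)⁻¹),
    ← Matrix.mul_assoc (K * Ψ₀) (Ψ₀ᵀ * G * Ψ), k2, Matrix.neg_mul,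
    Matrix.mul_nonsing_inv_cancel_right _ _ uA, Matrix.neg_mul]
  abel
end

section
/- Let M be a symmetric positive definite p×p real matrix and let (Ψ, Ψ₀) form a p×p orthogonal matrix, i.e., Ψ ∈ ℝ^{p×d} and Ψ₀ ∈ ℝ^{p×(p−d)} satisfy ΨᵀΨ = I_d, Ψ₀ᵀΨ₀ = I_{p−d}, ΨᵀΨ₀ = 0, and ΨΨᵀ + Ψ₀Ψ₀ᵀ = I_p. Set H = (Ψ₀ᵀ M Ψ)(Ψᵀ M Ψ)⁻¹ and K = Ψ₀ − Ψ Hᵀ. Then Kᵀ = (Ψ₀ᵀ M⁻¹ Ψ₀)⁻¹ Ψ₀ᵀ M⁻¹; equivalently, Ψ₀ᵀ (I_p − M Ψ (Ψᵀ M Ψ)⁻¹ Ψᵀ) = (Ψ₀ᵀ M⁻¹ Ψ₀)⁻¹ Ψ₀ᵀ M⁻¹. -/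
open Matrix

/-- Identity from Appendices A and B: with H = (Ψ₀ᵀMΨ)(ΨᵀMΨ)⁻¹ and K = Ψ₀ − ΨHᵀ,
one has Kᵀ = (Ψ₀ᵀM⁻¹Ψ₀)⁻¹Ψ₀ᵀM⁻¹; equivalently,
Ψ₀ᵀ(I − MΨ(ΨᵀMΨ)⁻¹Ψᵀ) = (Ψ₀ᵀM⁻¹Ψ₀)⁻¹Ψ₀ᵀM⁻¹. -/
theorem K_transpose_identity {p d : ℕ}
    (M : Matrix (Fin p) (Fin p) ℝ) (hM : M.PosDef)
    (Ψ : Matrix (Fin p) (Fin d) ℝ) (Ψ₀ : Matrix (Fin p) (Fin (p - d)) ℝ)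
    (hΨΨ : Ψᵀ * Ψ = 1) (hΨ₀Ψ₀ : Ψ₀ᵀ * Ψ₀ = 1) (hΨΨ₀ : Ψᵀ * Ψ₀ = 0)
    (hcomplete : Ψ * Ψᵀ + Ψ₀ * Ψ₀ᵀ = 1)
    (H : Matrix (Fin (p - d)) (Fin d) ℝ) (hH : H = (Ψ₀ᵀ * M * Ψ) * (Ψᵀ * M * Ψ)⁻¹)
    (K : Matrix (Fin p) (Fin (p - d)) ℝ) (hK : K = Ψ₀ - Ψ * Hᵀ) :
    Kᵀ = (Ψ₀ᵀ * M⁻¹ * Ψ₀)⁻¹ * Ψ₀ᵀ * M⁻¹ ∧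
    Ψ₀ᵀ * (1 - M * Ψ * (Ψᵀ * M * Ψ)⁻¹ * Ψᵀ) = (Ψ₀ᵀ * M⁻¹ * Ψ₀)⁻¹ * Ψ₀ᵀ * M⁻¹ := by
  have hS : IsUnit (Ψᵀ * M * Ψ).det := by
    have hinj : Function.Injective Ψ.mulVec := by
      intro x y hxy
      have h := congrArg (fun v => Ψᵀ *ᵥ v) hxy
      simpa [Matrix.mulVec_mulVec, hΨΨ] using h
    have h := hM.conjTranspose_mul_mul_same hinj
    rw [Matrix.conjTranspose_eq_transpose_of_trivial] at h
    exact h.det_pos.ne'.isUnit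
  have hMu : IsUnit M.det := hM.det_pos.ne'.isUnit
  obtain ⟨A, hA⟩ : ∃ A, A = Ψ₀ᵀ * (1 - M * Ψ * (Ψᵀ * M * Ψ)⁻¹ * Ψᵀ) := ⟨_, rfl⟩
  have hAK : Kᵀ = A := by
    rw [hK, hA, hH, Matrix.transpose_sub, Matrix.transpose_mul, Matrix.transpose_transpose]
    simp only [Matrix.mul_sub, Matrix.mul_one, Matrix.mul_assoc]
  have h1 : A * Ψ₀ = 1 := by
    rw [hA, Matrix.mul_assoc, Matrix.sub_mul, Matrix.mul_assoc _ Ψᵀ, hΨΨ₀]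
    simpa using hΨ₀Ψ₀
  have h2 : A * M * Ψ = 0 := by
    have e : A * M * Ψ = Ψ₀ᵀ * (M * Ψ - M * Ψ * ((Ψᵀ * M * Ψ)⁻¹ * (Ψᵀ * M * Ψ))) := by
      rw [hA]
      simp only [Matrix.mul_sub, Matrix.sub_mul, Matrix.mul_one, Matrix.mul_assoc]
    rw [e, Matrix.nonsing_inv_mul _ hS]
    simp
  have h3 : A = A * M * Ψ₀ * Ψ₀ᵀ * M⁻¹ := by
    have e : A * M = A * M * Ψ₀ * Ψ₀ᵀ := by
      calc A * M = A * M * (Ψ * Ψᵀ + Ψ₀ * Ψ₀ᵀ) := by rw [hcomplete, Matrix.mul_one]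
        _ = A * M * Ψ₀ * Ψ₀ᵀ := by
          rw [Matrix.mul_add, ← Matrix.mul_assoc, h2, Matrix.zero_mul, zero_add,
            ← Matrix.mul_assoc]
    rw [← e, Matrix.mul_assoc, Matrix.mul_nonsing_inv _ hMu, Matrix.mul_one]
  have h4 : (Ψ₀ᵀ * M⁻¹ * Ψ₀)⁻¹ = A * M * Ψ₀ := by
    apply Matrix.inv_eq_left_inv
    calc A * M * Ψ₀ * (Ψ₀ᵀ * M⁻¹ * Ψ₀) = (A * M * Ψ₀ * Ψ₀ᵀ * M⁻¹) * Ψ₀ := by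
          simp only [Matrix.mul_assoc]
      _ = 1 := by rw [← h3, h1]
  rw [hAK, ← hA, h4]
  exact ⟨h3, h3⟩
end

section
/- Let B₁,…,B_M be symmetric positive definite d×d real matrices, f₁,…,f_M positive reals with Σ_{m=1}^M f_m = 1, and B = Σ_{m=1}^M f_m B_m. Let Z₁,…,Z_M ∈ ℝ^d and Z̄ = Σ_{m=1}^M f_m Z_m. Then: (a) for every choice of vectors v₁,…,v_M ∈ ℝ^d with Σ_{m=1}^M f_m v_m = 0, one has Σ_{m=1}^M f_m (Z_m − B v_m)ᵀ B_m⁻¹ (Z_m − B v_m) ≥ Z̄ᵀ B⁻¹ Z̄; and (b) the choice v_m = B⁻¹ Z_m − B⁻¹ B_m B⁻¹ Z̄ satisfies Σ_{m=1}^M f_m v_m = 0 and attains equality. -/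
open Matrix BigOperators

lemma quad_lower_aux {d : ℕ} (A : Matrix (Fin d) (Fin d) ℝ) (hA : A.PosDef)
    (y w : Fin d → ℝ) :
    2 * (y ⬝ᵥ w) - (A.mulVec w) ⬝ᵥ w ≤ y ⬝ᵥ A⁻¹.mulVec y := by
  have hdet : IsUnit A.det := (Matrix.isUnit_iff_isUnit_det A).1 hA.isUnit
  have h := hA.inv.posSemidef.dotProduct_mulVec_nonneg (y - A.mulVec w)
  have h1 : A⁻¹.mulVec (A.mulVec w) = w := by
    rw [Matrix.mulVec_mulVec, Matrix.nonsing_inv_mul A hdet, Matrix.one_mulVec]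
  have hT : A⁻¹ᵀ = A⁻¹ := by
    have := hA.inv.isHermitian.eq
    rwa [Matrix.conjTranspose_eq_transpose_of_trivial] at this
  have h2 : (A.mulVec w) ⬝ᵥ A⁻¹.mulVec y = y ⬝ᵥ w := by
    rw [Matrix.dotProduct_mulVec, ← Matrix.mulVec_transpose, hT, h1, dotProduct_comm]
  rw [star_trivial, Matrix.mulVec_sub, h1, sub_dotProduct, dotProduct_sub, dotProduct_sub, h2] at h
  linarith

/-- Constrained quadratic minimization over the slice translation parameters v_m
(Appendix B, derivation of the profile likelihood of Theorem 1). -/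
theorem slice_translation_minimization {d M : ℕ}
    (Bm : Fin M → Matrix (Fin d) (Fin d) ℝ) (hBm : ∀ m, (Bm m).PosDef)
    (f : Fin M → ℝ) (hf : ∀ m, 0 < f m) (hfsum : ∑ m, f m = 1)
    (B : Matrix (Fin d) (Fin d) ℝ) (hB : B = ∑ m, f m • Bm m)
    (Z : Fin M → (Fin d → ℝ))
    (Zbar : Fin d → ℝ) (hZbar : Zbar = ∑ m, f m • Z m) :
    (∀ v : Fin M → (Fin d → ℝ), (∑ m, f m • v m) = 0 →
      ∑ m, f m * ((Z m - B.mulVec (v m)) ⬝ᵥ (Bm m)⁻¹.mulVec (Z m - B.mulVec (v m)))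
        ≥ Zbar ⬝ᵥ B⁻¹.mulVec Zbar) ∧
    ((∑ m, f m • (B⁻¹.mulVec (Z m) - B⁻¹.mulVec ((Bm m).mulVec (B⁻¹.mulVec Zbar)))) = 0 ∧
      ∑ m, f m * ((Z m - B.mulVec (B⁻¹.mulVec (Z m) - B⁻¹.mulVec ((Bm m).mulVec (B⁻¹.mulVec Zbar))))
          ⬝ᵥ (Bm m)⁻¹.mulVec
            (Z m - B.mulVec (B⁻¹.mulVec (Z m) - B⁻¹.mulVec ((Bm m).mulVec (B⁻¹.mulVec Zbar)))))
        = Zbar ⬝ᵥ B⁻¹.mulVec Zbar) := by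
  have hne : (Finset.univ : Finset (Fin M)).Nonempty := by
    by_contra hc
    rw [Finset.not_nonempty_iff_eq_empty] at hc
    rw [hc] at hfsum
    simp at hfsum
  have hBpd : B.PosDef := by
    rw [hB]
    haveI : Nonempty (Fin M) := Finset.univ_nonempty_iff.1 hne
    exact Matrix.posDef_sum hne (fun m _ => (hBm m).smul (hf m))
  have hdet : IsUnit B.det := (Matrix.isUnit_iff_isUnit_det B).1 hBpd.isUnit
  have hBi : ∀ x, B.mulVec (B⁻¹.mulVec x) = x := fun x => by
    rw [Matrix.mulVec_mulVec, Matrix.mul_nonsing_inv B hdet, Matrix.one_mulVec]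
  have hsumB : ∀ w, ∑ m, f m • (Bm m).mulVec w = B.mulVec w := fun w => by
    rw [hB, Matrix.sum_mulVec]
    simp only [Matrix.smul_mulVec]
  have hsumw : ∀ w, ∑ m, f m * ((Bm m).mulVec w ⬝ᵥ w) = B.mulVec w ⬝ᵥ w := fun w => by
    rw [← hsumB, sum_dotProduct]
    simp only [smul_dotProduct, smul_eq_mul]
  refine ⟨fun v hv => ?_, ?_, ?_⟩
  · have hy : ∑ m, f m • (Z m - B.mulVec (v m)) = Zbar := by
      have : ∑ m, f m • B.mulVec (v m) = 0 := by
        have h0 := congrArg B.mulVec hv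
        rw [Matrix.mulVec_sum, Matrix.mulVec_zero] at h0
        simpa only [Matrix.mulVec_smul] using h0
      simp only [smul_sub, Finset.sum_sub_distrib, this, sub_zero, hZbar]
    have hle : ∑ m, f m * (2 * ((Z m - B.mulVec (v m)) ⬝ᵥ B⁻¹.mulVec Zbar)
        - (Bm m).mulVec (B⁻¹.mulVec Zbar) ⬝ᵥ B⁻¹.mulVec Zbar) ≤
        ∑ m, f m * ((Z m - B.mulVec (v m)) ⬝ᵥ (Bm m)⁻¹.mulVec (Z m - B.mulVec (v m))) :=
      Finset.sum_le_sum fun m _ =>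
        mul_le_mul_of_nonneg_left (quad_lower_aux _ (hBm m) _ _) (hf m).le
    have hy2 : ∑ m, f m * ((Z m - B.mulVec (v m)) ⬝ᵥ B⁻¹.mulVec Zbar)
        = Zbar ⬝ᵥ B⁻¹.mulVec Zbar := by
      conv_rhs => rw [← hy, sum_dotProduct]
      simp only [smul_dotProduct, smul_eq_mul, hy]
    simp only [mul_sub, Finset.sum_sub_distrib, hsumw, hBi, mul_left_comm _ (2 : ℝ),
      ← Finset.mul_sum, hy2] at hle
    linarith
  · simp only [← Matrix.mulVec_sub, ← Matrix.mulVec_smul, ← Matrix.mulVec_sum]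
    simp only [smul_sub, Finset.sum_sub_distrib, hsumB, hBi, ← hZbar, sub_self,
      Matrix.mulVec_zero]
  · have hAi : ∀ m x, (Bm m)⁻¹.mulVec ((Bm m).mulVec x) = x := fun m x => by
      rw [Matrix.mulVec_mulVec, Matrix.nonsing_inv_mul _
        ((Matrix.isUnit_iff_isUnit_det _).1 (hBm m).isUnit), Matrix.one_mulVec]
    simp only [Matrix.mulVec_sub, hBi, sub_sub_cancel]
    simp only [hAi, hsumw, hBi]
end

section
/- Let M be a symmetric positive definite p×p real matrix, D a symmetric positive definite (p−d)×(p−d) real matrix, and let (Ψ, Ψ₀) form a p×p orthogonal matrix, i.e., Ψ ∈ ℝ^{p×d} and Ψ₀ ∈ ℝ^{p×(p−d)} satisfy ΨᵀΨ = I_d, Ψ₀ᵀΨ₀ = I_{p−d}, ΨᵀΨ₀ = 0, and ΨΨᵀ + Ψ₀Ψ₀ᵀ = I_p. For H ∈ ℝ^{(p−d)×d} let K_H = Ψ₀ − Ψ Hᵀ. Then the function H ↦ tr(M K_H D⁻¹ K_Hᵀ) attains its minimum over all H ∈ ℝ^{(p−d)×d} at Ĥ = (Ψ₀ᵀ M Ψ)(Ψᵀ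 M Ψ)⁻¹; that is, tr(M K_H D⁻¹ K_Hᵀ) ≥ tr(M K_Ĥ D⁻¹ K_Ĥᵀ) for all H. -/
open Matrix

/-- Minimization determining the MLE of H in Appendix B: the map
H ↦ tr(M K_H D⁻¹ K_Hᵀ), with K_H = Ψ₀ − ΨHᵀ, is minimized at Ĥ = (Ψ₀ᵀMΨ)(ΨᵀMΨ)⁻¹. -/
theorem H_trace_minimization {p d : ℕ}
    (M : Matrix (Fin p) (Fin p) ℝ) (hM : M.PosDef)
    (D : Matrix (Fin (p - d)) (Fin (p - d)) ℝ) (hD : D.PosDef)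
    (Ψ : Matrix (Fin p) (Fin d) ℝ) (Ψ₀ : Matrix (Fin p) (Fin (p - d)) ℝ)
    (hΨΨ : Ψᵀ * Ψ = 1) (hΨ₀Ψ₀ : Ψ₀ᵀ * Ψ₀ = 1) (hΨΨ₀ : Ψᵀ * Ψ₀ = 0)
    (hcomplete : Ψ * Ψᵀ + Ψ₀ * Ψ₀ᵀ = 1)
    (Hhat : Matrix (Fin (p - d)) (Fin d) ℝ)
    (hHhat : Hhat = (Ψ₀ᵀ * M * Ψ) * (Ψᵀ * M * Ψ)⁻¹) :
    ∀ H : Matrix (Fin (p - d)) (Fin d) ℝ,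
      (M * (Ψ₀ - Ψ * Hᵀ) * D⁻¹ * (Ψ₀ - Ψ * Hᵀ)ᵀ).trace
        ≥ (M * (Ψ₀ - Ψ * Hhatᵀ) * D⁻¹ * (Ψ₀ - Ψ * Hhatᵀ)ᵀ).trace := by
  intro H
  have hMt : Mᵀ = M := by
    have h := hM.1.eq
    rwa [conjTranspose_eq_transpose_of_trivial] at h
  have hS : (Ψᵀ * M * Ψ).PosDef := by
    have hinj : Function.Injective Ψ.mulVec := by
      intro x y hxy
      have h := congrArg (fun v => Ψᵀ *ᵥ v) hxy
      simpa [mulVec_mulVec, hΨΨ] using h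
    have h := hM.conjTranspose_mul_mul_same hinj
    rwa [conjTranspose_eq_transpose_of_trivial] at h
  have hdet : IsUnit (Ψᵀ * M * Ψ).det := isUnit_iff_ne_zero.mpr hS.det_pos.ne'
  set K := Ψ₀ - Ψ * Hhatᵀ with hK
  have h1 : Kᵀ * M * Ψ = 0 := by
    have h2 : Hhat * (Ψᵀ * M * Ψ) = Ψ₀ᵀ * M * Ψ := by
      rw [hHhat, Matrix.mul_assoc, nonsing_inv_mul _ hdet, Matrix.mul_one]
    rw [hK, transpose_sub, transpose_mul, transpose_transpose, Matrix.sub_mul, Matrix.sub_mul,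
      ← h2]
    simp only [Matrix.mul_assoc, sub_self]
  have h3 : Ψᵀ * M * K = 0 := by
    have h := congrArg transpose h1
    simpa [transpose_mul, hMt, Matrix.mul_assoc] using h
  obtain ⟨X, hX⟩ : ∃ X, X = Ψ * (Hhat - H)ᵀ := ⟨_, rfl⟩
  have hKX : Ψ₀ - Ψ * Hᵀ = K + X := by
    rw [hK, hX, transpose_sub, Matrix.mul_sub]; abel
  have e1 : (M * K * D⁻¹ * Xᵀ).trace = 0 := by
    have : (M * K * D⁻¹ * Xᵀ) = (M * K * D⁻¹ * (Hhat - H)) * Ψᵀ := by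
      rw [hX, transpose_mul, transpose_transpose]; simp only [Matrix.mul_assoc]
    rw [this, trace_mul_comm]
    have : Ψᵀ * (M * K * D⁻¹ * (Hhat - H)) = (Ψᵀ * M * K) * (D⁻¹ * (Hhat - H)) := by
      simp only [Matrix.mul_assoc]
    rw [this, h3]; simp
  have e2 : (M * X * D⁻¹ * Kᵀ).trace = 0 := by
    rw [trace_mul_comm]
    have : Kᵀ * (M * X * D⁻¹) = (Kᵀ * M * Ψ) * ((Hhat - H)ᵀ * D⁻¹) := by
      rw [hX]; simp only [Matrix.mul_assoc]
    rw [this, h1]; simp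
  have e3 : 0 ≤ (M * X * D⁻¹ * Xᵀ).trace := by
    obtain ⟨B, hB⟩ : ∃ B : Matrix (Fin (p - d)) (Fin (p - d)) ℝ, D⁻¹ = Bᴴ * B := by
      open scoped MatrixOrder in
      exact CStarAlgebra.nonneg_iff_eq_star_mul_self.mp hD.inv.posSemidef.nonneg
    have h := (hM.posSemidef.conjTranspose_mul_mul_same (X * Bᴴ)).trace_nonneg
    have : M * X * D⁻¹ * Xᵀ = (M * (X * Bᴴ)) * (X * Bᴴ)ᴴ := by
      rw [hB]
      simp only [conjTranspose_eq_transpose_of_trivial, transpose_mul, transpose_transpose,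
        Matrix.mul_assoc]
    rw [this, trace_mul_comm, ← Matrix.mul_assoc]
    exact h
  have : M * (K + X) * D⁻¹ * (K + X)ᵀ = M * K * D⁻¹ * Kᵀ + M * K * D⁻¹ * Xᵀ
      + M * X * D⁻¹ * Kᵀ + M * X * D⁻¹ * Xᵀ := by
    simp only [transpose_add, Matrix.mul_add, Matrix.add_mul]; abel
  rw [hKX, this]
  simp only [trace_add]
  linarith
end
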